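/- arXiv:1608.03335 — 2 statements merged into one kernel-verified Lean document; each statement's English description precedes it below -/
import Mathlib

section
/- Suppose the set-valued map z ↦ W(z) is continuous on Z with respect to the Hausdorff semimetric ρ_H, and suppose the averaged system is viable in Z (from every point of Z there is a solution of the averaged system remaining in Z for all t ≥ 0). Then for every compact set Ž contained in the interior of Z and every T > 0 there is a function β(ε,T) with lim_{ε→0} β(ε,T) = 0 such that: for every ε > 0, every control u_ε(·) and corresponding solution y_ε(·) of the perturbed system dy_ε/dt = ε⁻¹ f(u_ε(t),y_ε(t)) + g(u_ε(t),y_ε(t)), y_ε(0) = y₀, satisfying y_ε(t) ∈ Y and F(y_ε(t)) ∈ Ž for all t ∈ [0,∞), there exists a solution (μ(·), z(·)) of the averaged system with z(0) = F(y₀) and z(t) ∈ Z for all t ≥ 0 such that max_{t∈[0,T]} ‖F(y_ε(t)) − z(t)‖ ≤ β(ε,T) and |∫₀^T e^{−Ct} r(u_ε(t),y_ε(t)) dt − ∫₀^T e^{−Ct} r̃(μ(t)) dt| ≤ β(ε,T). -/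
open MeasureTheory Set Filter Metric
open scoped ENNReal NNReal Topology

noncomputable section

namespace SlowObs

abbrev Dd (d : ℕ) := EuclideanSpace ℝ (Fin d)
abbrev Em (m : ℕ) := EuclideanSpace ℝ (Fin m)
abbrev Kk (k : ℕ) := EuclideanSpace ℝ (Fin k)

variable {d m k : ℕ}

/-- A control: a measurable function with values in `U` at nonnegative times. -/
def IsControl (U : Set (Dd d)) (u : ℝ → Dd d) : Prop :=
  Measurable u ∧ ∀ t : ℝ, 0 ≤ t → u t ∈ U

/-- Carathéodory (integral-form) solution of `y'(t) = vf t (y t)` on `[0, ∞)`. -/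
def IsSolOn (vf : ℝ → Em m → Em m) (y : ℝ → Em m) : Prop :=
  ContinuousOn y (Ici 0) ∧
    (∀ T : ℝ, IntervalIntegrable (fun s => vf s (y s)) volume 0 T) ∧
    ∀ t : ℝ, 0 ≤ t → y t = y 0 + ∫ s in (0:ℝ)..t, vf s (y s)

/-- The level sets `Y_z = {y : F y = z}` (invariant sets of the reduced system). -/
def lvl (F : Em m → Kk k) (z : Kk k) : Set (Em m) := {y | F y = z}

/-- `h(u,y) := F'(y) g(u,y)`. -/
def hObs (F : Em m → Kk k) (g : Dd d → Em m → Em m) (p : Dd d × Em m) : Kk k :=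
  fderiv ℝ F p.2 (g p.1 p.2)

/-- Occupational measure generated on `[0,S]` by the pair `(u(·), y(·))`:
the pushforward of the normalized Lebesgue measure on `[0,S]` under `τ ↦ (u τ, y τ)`. -/
def occ (u : ℝ → Dd d) (y : ℝ → Em m) (S : ℝ) : Measure (Dd d × Em m) :=
  (ENNReal.ofReal S)⁻¹ • Measure.map (fun τ => (u τ, y τ)) (volume.restrict (Ioc 0 S))

/-- The set `W(z)`. -/
def W (U : Set (Dd d)) (f : Dd d → Em m → Em m) (F : Em m → Kk k) (z : Kk k) :
    Set (Measure (Dd d × Em m)) :=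
  {μ | IsProbabilityMeasure μ ∧ μ (U ×ˢ lvl F z) = 1 ∧
    ∀ φ : Em m → ℝ, ContDiff ℝ 1 φ → ∫ p, fderiv ℝ φ p.2 (f p.1 p.2) ∂μ = 0}

/-- The metric `ρ` on probability measures: the Lévy–Prokhorov (extended) distance. -/
def ρ (μ ν : Measure (Dd d × Em m)) : ℝ≥0∞ := levyProkhorovEDist μ ν

/-- Distance from a measure to a set of measures, `ρ(μ, Γ) = inf_{ν ∈ Γ} ρ(μ,ν)`. -/
def ρpt (μ : Measure (Dd d × Em m)) (Γ : Set (Measure (Dd d × Em m))) : ℝ≥0∞ :=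
  ⨅ ν ∈ Γ, ρ μ ν

/-- The Hausdorff semimetric `ρ_H` on sets of measures. -/
def ρH (Γ₁ Γ₂ : Set (Measure (Dd d × Em m))) : ℝ≥0∞ :=
  max (⨆ μ ∈ Γ₁, ρpt μ Γ₂) (⨆ μ ∈ Γ₂, ρpt μ Γ₁)

/-- Continuity of the set-valued map `z ↦ W(z)` on `Z` with respect to `ρ_H`. -/
def WCont (U : Set (Dd d)) (f : Dd d → Em m → Em m) (F : Em m → Kk k)
    (Z : Set (Kk k)) : Prop :=
  ∀ z ∈ Z, ∀ δ : ℝ≥0∞, 0 < δ → ∃ ε > (0:ℝ), ∀ z' ∈ Z, ‖z' - z‖ < ε →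
    ρH (W U f F z') (W U f F z) < δ

/-- `h̃(μ) = ∫ h dμ`. -/
def htilde (F : Em m → Kk k) (g : Dd d → Em m → Em m) (μ : Measure (Dd d × Em m)) : Kk k :=
  ∫ p, hObs F g p ∂μ

/-- `r̃(μ) = ∫ r dμ`. -/
def rtilde (r : Dd d → Em m → ℝ) (μ : Measure (Dd d × Em m)) : ℝ :=
  ∫ p, r p.1 p.2 ∂μ

/-- The set-valued map `V(z) = {(h̃ μ, r̃ μ) : μ ∈ W(z)} ⊆ ℝ^{k+1}`. -/
def Vmap (U : Set (Dd d)) (f : Dd d → Em m → Em m) (F : Em m → Kk k)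
    (g : Dd d → Em m → Em m) (r : Dd d → Em m → ℝ) (z : Kk k) : Set (Kk k × ℝ) :=
  (fun μ => (htilde F g μ, rtilde r μ)) '' W U f F z

/-- Lipschitz continuity of `V` on `Z` in the Hausdorff metric. -/
def VLip (U : Set (Dd d)) (f : Dd d → Em m → Em m) (F : Em m → Kk k)
    (g : Dd d → Em m → Em m) (r : Dd d → Em m → ℝ) (Z : Set (Kk k)) : Prop :=
  ∃ L : ℝ, 0 ≤ L ∧ ∀ z' ∈ Z, ∀ z'' ∈ Z,
    hausdorffDist (Vmap U f F g r z') (Vmap U f F g r z'') ≤ L * ‖z' - z''‖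

/-- A solution `(μ(·), z(·))` of the averaged system with initial value `z₀`. -/
def IsAveragedSol (U : Set (Dd d)) (f : Dd d → Em m → Em m) (F : Em m → Kk k)
    (g : Dd d → Em m → Em m) (z₀ : Kk k)
    (μt : ℝ → Measure (Dd d × Em m)) (z : ℝ → Kk k) : Prop :=
  z 0 = z₀ ∧ ContinuousOn z (Ici 0) ∧
    (∀ T : ℝ, IntervalIntegrable (fun s => htilde F g (μt s)) volume 0 T) ∧
    (∀ t : ℝ, 0 ≤ t → z t = z₀ + ∫ s in (0:ℝ)..t, htilde F g (μt s)) ∧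
    (∀ t : ℝ, 0 ≤ t → μt t ∈ W U f F (z t))

/-- Viability of the averaged system in `Z`. -/
def AveragedViable (U : Set (Dd d)) (f : Dd d → Em m → Em m) (F : Em m → Kk k)
    (g : Dd d → Em m → Em m) (Z : Set (Kk k)) : Prop :=
  ∀ z₀ ∈ Z, ∃ μt zf, IsAveragedSol U f F g z₀ μt zf ∧ ∀ t : ℝ, 0 ≤ t → zf t ∈ Z

/-- Viability of the augmented perturbed system in `Y × Z`. -/
def AugViable (U : Set (Dd d)) (f g : Dd d → Em m → Em m) (F : Em m → Kk k)
    (Yset : Set (Em m)) (Z : Set (Kk k)) : Prop :=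
  ∀ ε > (0:ℝ), ∀ y₀ ∈ Yset, ∀ z₀ ∈ Z, ∃ u y zf,
    IsControl U u ∧ IsSolOn (fun s x => ε⁻¹ • f (u s) x + g (u s) x) y ∧ y 0 = y₀ ∧
    ContinuousOn zf (Ici 0) ∧ zf 0 = z₀ ∧
    (∀ T : ℝ, IntervalIntegrable (fun s => hObs F g (u s, y s)) volume 0 T) ∧
    (∀ t : ℝ, 0 ≤ t → zf t = z₀ + ∫ s in (0:ℝ)..t, hObs F g (u s, y s)) ∧
    (∀ t : ℝ, 0 ≤ t → y t ∈ Yset ∧ zf t ∈ Z)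

/-- The set `M_z(S, y₀)` of occupational measures on `[0,S]` of reduced solutions from `y₀`. -/
def Mz (U : Set (Dd d)) (f : Dd d → Em m → Em m) (S : ℝ) (y₀ : Em m) :
    Set (Measure (Dd d × Em m)) :=
  {μ | ∃ u y, IsControl U u ∧ IsSolOn (fun s x => f (u s) x) y ∧ y 0 = y₀ ∧ μ = occ u y S}

/-- Assumption 2 of the paper: `sup_{μ ∈ W(z)} ρ(μ, M_z(S,y₀)) ≤ β(S) → 0`,
uniformly over `y₀ ∈ Y_z` and `z ∈ Z`. -/
def Assumption2 (U : Set (Dd d)) (f : Dd d → Em m → Em m) (F : Em m → Kk k)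
    (Z : Set (Kk k)) : Prop :=
  ∃ β : ℝ → ℝ, Tendsto β atTop (𝓝 0) ∧
    ∀ z ∈ Z, ∀ y₀ ∈ lvl F z, ∀ S > (0:ℝ), ∀ μ ∈ W U f F z,
      ρpt μ (Mz U f S y₀) ≤ ENNReal.ofReal (β S)

/-- Optimal value `R^*(ε, y₀)` of the perturbed problem (shrinked time scale). -/
def Rstar (U : Set (Dd d)) (f g : Dd d → Em m → Em m) (r : Dd d → Em m → ℝ)
    (C : ℝ) (y₀ : Em m) (ε : ℝ) : ℝ :=
  sInf {v | ∃ u y, IsControl U u ∧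
    IsSolOn (fun s x => ε⁻¹ • f (u s) x + g (u s) x) y ∧ y 0 = y₀ ∧
    v = ∫ t in Ioi (0:ℝ), Real.exp (-C * t) * r (u t) (y t)}

/-- Optimal value `R̃^*` of the averaged problem. -/
def RtildeStar (U : Set (Dd d)) (f : Dd d → Em m → Em m) (F : Em m → Kk k)
    (g : Dd d → Em m → Em m) (r : Dd d → Em m → ℝ) (C : ℝ) (z₀ : Kk k) : ℝ :=
  sInf {v | ∃ μt z, IsAveragedSol U f F g z₀ μt z ∧
    v = ∫ t in Ioi (0:ℝ), Real.exp (-C * t) * rtilde r (μt t)}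

/-- Bilinear form `wᵀ Q v` of a matrix. -/
def matBil (Q : Matrix (Fin m) (Fin m) ℝ) (w v : Em m) : ℝ :=
  ∑ i, w i * Q.mulVec (fun j => v j) i

/-- The pair `(u(·), y(·))` generates the occupational measure `μ` on `[0,∞)`. -/
def GeneratesOM (u : ℝ → Dd d) (y : ℝ → Em m) (μ : Measure (Dd d × Em m)) : Prop :=
  IsProbabilityMeasure μ ∧ ∀ q : Dd d × Em m → ℝ, Continuous q →
    Tendsto (fun S : ℝ => S⁻¹ * ∫ τ in (0:ℝ)..S, q (u τ, y τ)) atTop (𝓝 (∫ p, q p ∂μ))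

/-- An average control generating (ACG) family `(u_z(·), y_z(·))` with occupational
measures `μ_z` and the (unique) solution `zsol` of `z'(t) = h̃(μ_{z(t)})`, `z 0 = z₀`. -/
def IsACG (U : Set (Dd d)) (f : Dd d → Em m → Em m) (F : Em m → Kk k)
    (g : Dd d → Em m → Em m) (Z : Set (Kk k)) (z₀ : Kk k)
    (uz : Kk k → ℝ → Dd d) (yz : Kk k → ℝ → Em m)
    (μz : Kk k → Measure (Dd d × Em m)) (zsol : ℝ → Kk k) : Prop :=
  (∀ z ∈ Z, IsControl U (uz z)) ∧
  (∀ z ∈ Z, IsSolOn (fun s x => f (uz z s) x) (yz z)) ∧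
  (∀ z ∈ Z, ∀ τ : ℝ, 0 ≤ τ → yz z τ ∈ lvl F z) ∧
  (∀ z ∈ Z, IsProbabilityMeasure (μz z)) ∧
  (∀ q : Dd d × Em m → ℝ, Continuous q →
    ∃ αq : ℝ → ℝ, Tendsto αq atTop (𝓝 0) ∧ ∀ z ∈ Z, ∀ S > (0:ℝ),
      |S⁻¹ * (∫ τ in (0:ℝ)..S, q (uz z τ, yz z τ)) - ∫ p, q p ∂(μz z)| ≤ αq S) ∧
  (∀ q : Dd d × Em m → ℝ, Continuous q → Measurable fun z => ∫ p, q p ∂(μz z)) ∧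
  zsol 0 = z₀ ∧ ContinuousOn zsol (Ici 0) ∧
  (∀ T : ℝ, IntervalIntegrable (fun s => htilde F g (μz (zsol s))) volume 0 T) ∧
  (∀ t : ℝ, 0 ≤ t → zsol t = z₀ + ∫ s in (0:ℝ)..t, htilde F g (μz (zsol s))) ∧
  (∀ t : ℝ, 0 ≤ t → zsol t ∈ Z) ∧
  (∀ w : ℝ → Kk k, w 0 = z₀ → ContinuousOn w (Ici 0) →
    (∀ T : ℝ, IntervalIntegrable (fun s => htilde F g (μz (w s))) volume 0 T) →
    (∀ t : ℝ, 0 ≤ t → w t = z₀ + ∫ s in (0:ℝ)..t, htilde F g (μz (w s))) →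
    (∀ t : ℝ, 0 ≤ t → w t ∈ Z) → ∀ t : ℝ, 0 ≤ t → w t = zsol t)

/-- Periodicity of an ACG family. -/
def ACGPeriodic (Z : Set (Kk k)) (uz : Kk k → ℝ → Dd d) (yz : Kk k → ℝ → Em m) : Prop :=
  ∀ z ∈ Z, ∃ T > (0:ℝ), ∀ τ : ℝ, 0 ≤ τ →
    uz z (τ + T) = uz z τ ∧ yz z (τ + T) = yz z τ

/-- Optimality of an ACG family in the averaged problem. -/
def ACGOptimal (U : Set (Dd d)) (f : Dd d → Em m → Em m) (F : Em m → Kk k)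
    (g : Dd d → Em m → Em m) (r : Dd d → Em m → ℝ) (C : ℝ) (z₀ : Kk k)
    (μz : Kk k → Measure (Dd d × Em m)) (zsol : ℝ → Kk k) : Prop :=
  (∫ t in Ioi (0:ℝ), Real.exp (-C * t) * rtilde r (μz (zsol t))) =
    RtildeStar U f F g r C z₀

/-- The set `D̃(z₀)` of discounted occupational measures supported on the graph of `W`. -/
def Dtilde (U : Set (Dd d)) (f : Dd d → Em m → Em m) (F : Em m → Kk k)
    (g : Dd d → Em m → Em m) (Z : Set (Kk k)) (C : ℝ) (z₀ : Kk k) :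
    Set (Measure (Measure (Dd d × Em m) × Kk k)) :=
  {p | IsProbabilityMeasure p ∧ p {q | q.2 ∈ Z ∧ q.1 ∈ W U f F q.2} = 1 ∧
    ∀ ψ : Kk k → ℝ, ContDiff ℝ 1 ψ →
      ∫ q, (fderiv ℝ ψ q.2 (htilde F g q.1) + C * (ψ z₀ - ψ q.2)) ∂p = 0}

/-- `ã^*(z₀)`: the optimal value of the IDLP problem. -/
def astar (U : Set (Dd d)) (f : Dd d → Em m → Em m) (F : Em m → Kk k)
    (g : Dd d → Em m → Em m) (r : Dd d → Em m → ℝ) (Z : Set (Kk k)) (C : ℝ)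
    (z₀ : Kk k) : ℝ :=
  sInf ((fun p => ∫ q, rtilde r q.1 ∂p) '' Dtilde U f F g Z C z₀)

/-- The Hamiltonian `H̃(p,z)` of the averaged system (`p` a linear functional). -/
def Htilde (U : Set (Dd d)) (f : Dd d → Em m → Em m) (F : Em m → Kk k)
    (g : Dd d → Em m → Em m) (r : Dd d → Em m → ℝ) (p : Kk k →L[ℝ] ℝ) (z : Kk k) : ℝ :=
  sInf ((fun μ => rtilde r μ + p (htilde F g μ)) '' W U f F z)

/-- Assumption V: existence of solutions `ζ*` of the averaged dual problem and `η*_z`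
of the associated dual problems. -/
def AssumptionV (U : Set (Dd d)) (f : Dd d → Em m → Em m) (F : Em m → Kk k)
    (g : Dd d → Em m → Em m) (r : Dd d → Em m → ℝ) (Z : Set (Kk k)) (C : ℝ)
    (z₀ : Kk k) (ζs : Kk k → ℝ) (ηs : Kk k → Em m → ℝ) : Prop :=
  ContDiff ℝ 1 ζs ∧ (∀ z, ContDiff ℝ 1 (ηs z)) ∧
  IsLeast ((fun z => Htilde U f F g r (fderiv ℝ ζs z) z + C * (ζs z₀ - ζs z)) '' Z)
    (astar U f F g r Z C z₀) ∧
  ∀ z ∈ Z, IsLeast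
    ((fun p : Dd d × Em m =>
        r p.1 p.2 + fderiv ℝ ζs z (hObs F g p) + fderiv ℝ (ηs z) p.2 (f p.1 p.2)) ''
      (U ×ˢ lvl F z))
    (Htilde U f F g r (fderiv ℝ ζs z) z)

/-- The occupational measure of a `T`-periodic orbit `y(·)` (a measure on the state space). -/
def perOcc (y : ℝ → Em m) (T : ℝ) : Measure (Em m) :=
  (ENNReal.ofReal T)⁻¹ • Measure.map y (volume.restrict (Ioc 0 T))

/-- Assumption III: for each `z ∈ Z`, the uncontrolled reduced system has a `T_z`-periodic
solution in `Y_z` (periods uniformly bounded), and every solution starting in `Y_z`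
is a time shift of it. -/
def AssumptionIII (f0 : Em m → Em m) (F : Em m → Kk k) (Z : Set (Kk k))
    (yper : Kk k → ℝ → Em m) (Tper : Kk k → ℝ) : Prop :=
  (∃ T₀ : ℝ, ∀ z ∈ Z, 0 < Tper z ∧ Tper z ≤ T₀) ∧
  (∀ z ∈ Z, IsSolOn (fun _ x => f0 x) (yper z)) ∧
  (∀ z ∈ Z, ∀ τ : ℝ, yper z τ ∈ lvl F z) ∧
  (∀ z ∈ Z, ∀ τ : ℝ, yper z (τ + Tper z) = yper z τ) ∧
  (∀ z ∈ Z, ∀ y : ℝ → Em m, IsSolOn (fun _ x => f0 x) y → y 0 ∈ lvl F z →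
    ∃ s : ℝ, ∀ τ : ℝ, 0 ≤ τ → y τ = yper z (τ + s))

/-- Assumption IV: existence, for each `z ∈ Z`, of a solution `ȳ_z` generating an
occupational measure `ν_z`, which asymptotically attracts (up to time shifts) every
solution staying in `Y_z`. -/
def AssumptionIV (f0 : Em m → Em m) (F : Em m → Kk k) (Z : Set (Kk k))
    (ybar : Kk k → ℝ → Em m) (ν : Kk k → Measure (Em m)) : Prop :=
  (∀ z ∈ Z, IsSolOn (fun _ x => f0 x) (ybar z)) ∧
  (∀ z ∈ Z, ∀ τ : ℝ, 0 ≤ τ → ybar z τ ∈ lvl F z) ∧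
  (∀ z ∈ Z, IsProbabilityMeasure (ν z) ∧ ν z (lvl F z) = 1) ∧
  (∀ q : Em m → ℝ, Continuous q → ∃ κ : ℝ → ℝ, Tendsto κ atTop (𝓝 0) ∧
    ∀ z ∈ Z, ∀ S > (0:ℝ),
      |S⁻¹ * (∫ τ in (0:ℝ)..S, q (ybar z τ)) - ∫ x, q x ∂(ν z)| ≤ κ S) ∧
  (∃ α₁ α₂ : ℝ → ℝ, Tendsto α₁ atTop (𝓝 0) ∧ Tendsto α₂ atTop (𝓝 0) ∧
    (∀ S > (0:ℝ), 0 < α₁ S ∧ 0 < α₂ S) ∧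
    ∀ z ∈ Z, ∀ y : ℝ → Em m, IsSolOn (fun _ x => f0 x) y →
      (∀ τ : ℝ, 0 ≤ τ → y τ ∈ lvl F z) → ∀ S > (0:ℝ),
        ∃ θ : ℝ, 0 ≤ θ ∧ θ / S ≤ α₂ S ∧
          ∀ τ ∈ Icc (0:ℝ) S, ‖y (τ + θ) - ybar z τ‖ ≤ α₁ S)

section
open ProbabilityTheory

/-- Young-measure compactness: along an ultrafilter, the graphs of measurable functions into a
compact space converge to a Markov kernel. -/
theorem exists_kernel_tendsto_integral {A ι : Type*} [MetricSpace A] [CompactSpace A] [Nonempty A]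
    [MeasurableSpace A] [BorelSpace A] (𝒰 : Ultrafilter ι) {T : ℝ} (hT : 0 < T)
    (w : ι → ℝ → A) (hw : ∀ i, Measurable (w i)) :
    ∃ κ : Kernel ℝ A, IsMarkovKernel κ ∧ ∀ G : ℝ × A → ℝ, Continuous G →
      Tendsto (fun i => ∫ t in (0:ℝ)..T, G (t, w i t)) 𝒰
        (𝓝 (∫ t in (0:ℝ)..T, ∫ p, G (t, p) ∂κ t)) := by
  let lam : Measure ℝ := (ENNReal.ofReal T)⁻¹ • volume.restrict (Ioc 0 T)
  have hlamP : IsProbabilityMeasure lam := ⟨by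
    simp only [lam, Measure.smul_apply, Measure.restrict_apply MeasurableSet.univ, univ_inter,
      Real.volume_Ioc, sub_zero, smul_eq_mul]
    exact ENNReal.inv_mul_cancel (by simpa using hT) ENNReal.ofReal_ne_top⟩
  have hlam : ∀ a : ℝ → ℝ, ∫ t, a t ∂lam = T⁻¹ * ∫ t in (0:ℝ)..T, a t := fun a => by
    simp only [lam]
    rw [integral_smul_measure, intervalIntegral.integral_of_le hT.le, smul_eq_mul,
      ENNReal.toReal_inv, ENNReal.toReal_ofReal hT.le]
  let π : ℝ → Icc (0:ℝ) T := projIcc 0 T hT.le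
  have hπ : Measurable π := continuous_projIcc.measurable
  have hΦ : ∀ i, Measurable fun t => (π t, w i t) := fun i => hπ.prodMk (hw i)
  let γ : ι → ProbabilityMeasure (Icc (0:ℝ) T × A) := fun i =>
    ⟨lam.map fun t => (π t, w i t), Measure.isProbabilityMeasure_map (hΦ i).aemeasurable⟩
  let ν := (Ultrafilter.map γ 𝒰).lim
  have hν : Tendsto γ 𝒰 (𝓝 ν) := Ultrafilter.le_nhds_lim (Ultrafilter.map γ 𝒰)
  have hfst : (ν : Measure (Icc (0:ℝ) T × A)).fst = lam.map π := by
    have h1 := ProbabilityMeasure.tendsto_map_of_tendsto_of_continuous γ ν hν continuous_fst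
    have h2 : ∀ i, (γ i).map (continuous_fst.measurable.aemeasurable) =
        (⟨lam.map π, Measure.isProbabilityMeasure_map hπ.aemeasurable⟩ :
          ProbabilityMeasure (Icc (0:ℝ) T)) := fun i => by
      apply Subtype.ext
      simp only [γ]
      exact Measure.map_map measurable_fst (hΦ i)
    simp only [h2] at h1
    have h3 := tendsto_nhds_unique h1 tendsto_const_nhds
    exact congrArg Subtype.val h3
  refine ⟨(ν : Measure (Icc (0:ℝ) T × A)).condKernel.comap π hπ, inferInstance, fun G hG => ?_⟩
  let G' : C(Icc (0:ℝ) T × A, ℝ) := ⟨fun p => G (p.1, p.2), by fun_prop⟩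
  have h1 := (ProbabilityMeasure.continuous_integral_continuousMap G').tendsto ν |>.comp hν
  have h2 : ∀ i, ∫ p, G' p ∂(γ i : Measure (Icc (0:ℝ) T × A)) =
      T⁻¹ * ∫ t in (0:ℝ)..T, G (t, w i t) := fun i => by
    simp only [γ, ProbabilityMeasure.coe_mk]
    rw [integral_map (hΦ i).aemeasurable G'.continuous.aestronglyMeasurable, hlam]
    congr 1
    refine intervalIntegral.integral_congr fun t ht => ?_
    rw [uIcc_of_le hT.le] at ht
    simp [G', π, projIcc_of_mem hT.le ht]
  have hint : Integrable (fun p => G' p) (ν : Measure (Icc (0:ℝ) T × A)) :=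
    G'.continuous.integrable_of_hasCompactSupport (HasCompactSupport.of_compactSpace _)
  have h3 : ∫ p, G' p ∂(ν : Measure (Icc (0:ℝ) T × A)) =
      T⁻¹ * ∫ t in (0:ℝ)..T, ∫ p, G (t, p)
        ∂((ν : Measure (Icc (0:ℝ) T × A)).condKernel.comap π hπ t) := by
    rw [← Measure.integral_condKernel hint, hfst, integral_map hπ.aemeasurable
      (by rw [← hfst]; exact hint.1.integral_condKernel), hlam]
    congr 1
    refine intervalIntegral.integral_congr fun t ht => ?_
    rw [uIcc_of_le hT.le] at ht
    simp [G', π, projIcc_of_mem hT.le ht]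
  have h4 : Tendsto (fun i => T⁻¹ * ∫ t in (0:ℝ)..T, G (t, w i t)) 𝒰
      (𝓝 (T⁻¹ * ∫ t in (0:ℝ)..T, ∫ p, G (t, p)
        ∂((ν : Measure (Icc (0:ℝ) T × A)).condKernel.comap π hπ t))) := by
    rw [← h3]
    exact h1.congr h2
  simpa [hT.ne'] using h4.const_mul T

/-- Convergence of all bounded continuous time-dependent observables on `[0, T]` implies convergence
of the integrals on every `[0, s]`. -/
theorem tendsto_integral_cut {A ι : Type*} [MetricSpace A] [CompactSpace A]
    [MeasurableSpace A] [BorelSpace A] {l : Filter ι} {T : ℝ}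
    {w : ι → ℝ → A} (hw : ∀ i, Measurable (w i)) {κ : Kernel ℝ A} [IsMarkovKernel κ]
    (hκ : ∀ G : ℝ × A → ℝ, Continuous G →
      Tendsto (fun i => ∫ t in (0:ℝ)..T, G (t, w i t)) l
        (𝓝 (∫ t in (0:ℝ)..T, ∫ p, G (t, p) ∂κ t)))
    {q : A → ℝ} (hq : Continuous q) {s : ℝ} (hs : s ∈ Icc 0 T) :
    Tendsto (fun i => ∫ t in (0:ℝ)..s, q (w i t)) l
        (𝓝 (∫ t in (0:ℝ)..s, ∫ p, q p ∂κ t)) := by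
  obtain ⟨M, hM⟩ : ∃ M, ∀ p, ‖q p‖ ≤ M := by
    obtain ⟨M, hM⟩ := isCompact_univ.exists_bound_of_continuousOn hq.continuousOn
    exact ⟨M, fun p => hM p (mem_univ p)⟩
  let ψ : ℝ → ℝ → ℝ := fun δ t => max 0 (min 1 (1 - (t - s) / δ))
  have hψc : ∀ δ, Continuous (ψ δ) := fun δ => by fun_prop
  have hψ0 : ∀ δ t, 0 ≤ ψ δ t := fun δ t => le_max_left _ _
  have hψ1 : ∀ δ t, ψ δ t ≤ 1 := fun δ t => max_le zero_le_one (min_le_left _ _)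
  have hii : ∀ a : ℝ → ℝ, Measurable a → (∀ t, ‖a t‖ ≤ M) → ∀ b c,
      IntervalIntegrable a volume b c := fun a ha hb b c =>
    (intervalIntegrable_const (c := M)).mono_fun ha.aestronglyMeasurable
      (ae_of_all _ fun t => (hb t).trans (le_abs_self M))
  have key : ∀ a : ℝ → ℝ, Measurable a → (∀ t, ‖a t‖ ≤ M) → ∀ δ > 0,
      |(∫ t in (0:ℝ)..T, ψ δ t * a t) - ∫ t in (0:ℝ)..s, a t| ≤ M * δ := by
    intro a ha hb δ hδ
    have hb' : ∀ t, ‖ψ δ t * a t‖ ≤ M := fun t => by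
      rw [norm_mul, Real.norm_of_nonneg (hψ0 δ t)]
      exact (mul_le_of_le_one_left (norm_nonneg _) (hψ1 δ t)).trans (hb t)
    have hi := hii (fun t => ψ δ t * a t) ((hψc δ).measurable.mul ha) hb'
    have hs' : s ≤ min (s + δ) T := le_min (by linarith) hs.2
    have e1 : ∫ t in (0:ℝ)..s, ψ δ t * a t = ∫ t in (0:ℝ)..s, a t := by
      refine intervalIntegral.integral_congr fun t ht => ?_
      rw [uIcc_of_le hs.1] at ht
      have : 0 ≤ (s - t) / δ := div_nonneg (by linarith [ht.2]) hδ.le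
      have h2 : (t - s) / δ = - ((s - t) / δ) := by ring
      have : ψ δ t = 1 := by
        simp only [ψ]
        rw [min_eq_left (by linarith), max_eq_right zero_le_one]
      simp [this]
    have e2 : ∫ t in (min (s + δ) T)..T, ψ δ t * a t = 0 := by
      rw [← intervalIntegral.integral_zero (μ := volume) (a := min (s + δ) T) (b := T)]
      rcases le_total (s + δ) T with h | h
      · refine intervalIntegral.integral_congr fun t ht => ?_
        rw [min_eq_left h, uIcc_of_le h] at ht
        have : 1 ≤ (t - s) / δ := by rw [le_div_iff₀ hδ]; linarith [ht.1]
        have : ψ δ t = 0 := max_eq_left ((min_le_right _ _).trans (by linarith))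
        simp [this]
      · simp [min_eq_right h]
    rw [← intervalIntegral.integral_add_adjacent_intervals (hi 0 s) (hi s T),
      ← intervalIntegral.integral_add_adjacent_intervals (hi s (min (s + δ) T)) (hi _ T), e1, e2]
    have := intervalIntegral.norm_integral_le_of_norm_le_const (a := s) (b := min (s + δ) T)
      (f := fun t => ψ δ t * a t) (C := M) (fun t _ => hb' t)
    rw [abs_of_nonneg (by linarith), Real.norm_eq_abs] at this
    have hM0 : 0 ≤ M := (norm_nonneg _).trans (hb 0)
    have h3 : min (s + δ) T - s ≤ δ := by linarith [min_le_left (s + δ) T]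
    rw [add_zero, add_sub_cancel_left]
    exact this.trans (mul_le_mul_of_nonneg_left h3 hM0)
  have hm : Measurable fun t => ∫ p, q p ∂κ t :=
    (StronglyMeasurable.integral_kernel hq.stronglyMeasurable).measurable
  have hmb : ∀ t, ‖∫ p, q p ∂κ t‖ ≤ M := fun t => by
    simpa using norm_integral_le_of_norm_le_const (μ := κ t) (ae_of_all _ hM)
  have hM1 : 0 < |M| + 1 := by positivity
  rw [Metric.tendsto_nhds]
  intro η hη
  let δ := η / (4 * (|M| + 1))
  have hδ : 0 < δ := by positivity
  have hMδ : M * δ ≤ η / 4 := by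
    have : (|M| + 1) * δ = η / 4 := by simp only [δ]; field_simp
    nlinarith [le_abs_self M]
  have h := hκ (fun p => ψ δ p.1 * q p.2) (by fun_prop)
  simp only [integral_const_mul] at h
  filter_upwards [Metric.tendsto_nhds.1 h (η / 4) (by positivity)] with i hi
  have k1 := key _ (hq.measurable.comp (hw i)) (fun t => hM _) δ hδ
  have k2 := key _ hm hmb δ hδ
  simp only [Real.dist_eq, Function.comp_apply] at hi k1 ⊢
  rw [abs_lt] at hi ⊢
  rw [abs_le] at k1 k2
  constructor <;> linarith

theorem tendsto_euclidean_integral_cut {A ι : Type*} [MetricSpace A] [CompactSpace A]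
    [MeasurableSpace A] [BorelSpace A] {l : Filter ι} {T : ℝ} {k : ℕ}
    {w : ι → ℝ → A} (hw : ∀ i, Measurable (w i)) {κ : Kernel ℝ A} [IsMarkovKernel κ]
    (hκ : ∀ G : ℝ × A → ℝ, Continuous G →
      Tendsto (fun i => ∫ t in (0:ℝ)..T, G (t, w i t)) l
        (𝓝 (∫ t in (0:ℝ)..T, ∫ p, G (t, p) ∂κ t)))
    {q : A → EuclideanSpace ℝ (Fin k)} (hq : Continuous q) {s : ℝ} (hs : s ∈ Icc 0 T) :
    Tendsto (fun i => ∫ t in (0:ℝ)..s, q (w i t)) l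
        (𝓝 (∫ t in (0:ℝ)..s, ∫ p, q p ∂κ t)) := by
  obtain ⟨M, hM⟩ : ∃ M, ∀ p, ‖q p‖ ≤ M := by
    obtain ⟨M, hM⟩ := isCompact_univ.exists_bound_of_continuousOn hq.continuousOn
    exact ⟨M, fun p => hM p (mem_univ p)⟩
  have hii : ∀ a : ℝ → EuclideanSpace ℝ (Fin k), Measurable a → (∀ t, ‖a t‖ ≤ M) →
      IntervalIntegrable a volume 0 s := fun a ha hb =>
    (intervalIntegrable_const (c := M)).mono_fun ha.aestronglyMeasurable
      (ae_of_all _ fun t => (hb t).trans (le_abs_self M))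
  have hm : Measurable fun t => ∫ p, q p ∂κ t :=
    (StronglyMeasurable.integral_kernel hq.stronglyMeasurable).measurable
  have hmb : ∀ t, ‖∫ p, q p ∂κ t‖ ≤ M := fun t => by
    simpa using norm_integral_le_of_norm_le_const (μ := κ t) (ae_of_all _ hM)
  have hqi : ∀ t, Integrable q (κ t) := fun t =>
    hq.integrable_of_hasCompactSupport (HasCompactSupport.of_compactSpace _)
  let e := EuclideanSpace.equiv (Fin k) ℝ
  rw [e.toHomeomorph.isInducing.tendsto_nhds_iff, tendsto_pi_nhds]
  intro j
  have c1 : ∀ i, (∫ t in (0:ℝ)..s, q (w i t)) j = ∫ t in (0:ℝ)..s, q (w i t) j := fun i =>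
    ((EuclideanSpace.proj (𝕜 := ℝ) j).intervalIntegral_comp_comm
      (hii _ (hq.measurable.comp (hw i)) fun t => hM _)).symm
  have c2 : (∫ t in (0:ℝ)..s, ∫ p, q p ∂κ t) j = ∫ t in (0:ℝ)..s, ∫ p, q p j ∂κ t :=
    ((EuclideanSpace.proj (𝕜 := ℝ) j).intervalIntegral_comp_comm (hii _ hm hmb)).symm.trans <|
      intervalIntegral.integral_congr fun t _ =>
        ((EuclideanSpace.proj (𝕜 := ℝ) j).integral_comp_comm (hqi t)).symm
  have := tendsto_integral_cut hw hκ (q := fun p => q p j)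
    ((EuclideanSpace.proj (𝕜 := ℝ) j).continuous.comp hq) hs
  simp only [← c1, ← c2] at this
  exact this

/-- A family of continuous observables with a.e. vanishing averages has them vanishing
simultaneously a.e. -/
theorem ae_forall_integral_eq_zero {A : Type*} [MetricSpace A] [CompactSpace A]
    [MeasurableSpace A] [BorelSpace A] {κ : Kernel ℝ A} [IsMarkovKernel κ] {μ : Measure ℝ}
    (S : Set C(A, ℝ)) (h : ∀ q ∈ S, ∀ᵐ t ∂μ, ∫ p, q p ∂κ t = 0) :
    ∀ᵐ t ∂μ, ∀ q ∈ S, ∫ p, q p ∂κ t = 0 := by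
  obtain ⟨D, hDS, hDc, hD⟩ := (TopologicalSpace.IsSeparable.of_separableSpace S).exists_countable_dense_subset
  have := (ae_ball_iff hDc).2 fun q hq => h q (hDS hq)
  filter_upwards [this] with t ht q hq
  have hcl : IsClosed {q : C(A, ℝ) | ∫ p, q p ∂κ t = 0} := by
    refine isClosed_eq (LipschitzWith.of_dist_le_mul (K := 1) fun q q' => ?_).continuous
      continuous_const
    have hint : ∀ q : C(A, ℝ), Integrable q (κ t) := fun q =>
      q.continuous.integrable_of_hasCompactSupport (HasCompactSupport.of_compactSpace _)
    rw [dist_eq_norm, ← integral_sub (hint q) (hint q'), NNReal.coe_one, one_mul]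
    refine (norm_integral_le_of_norm_le_const (C := dist q q')
      (ae_of_all _ fun p => ?_)).trans (by simp)
    rw [← dist_eq_norm]
    exact ContinuousMap.dist_apply_le_dist p
  exact hcl.closure_subset_iff.2 ht (hD hq)

theorem ae_eq_zero_of_integral_eq_zero {a : ℝ → ℝ} {T : ℝ} (hT : 0 < T)
    (ha : IntervalIntegrable a volume 0 T) (h : ∀ s ∈ Icc 0 T, ∫ t in (0:ℝ)..s, a t = 0) :
    ∀ᵐ t ∂(volume.restrict (Icc 0 T)), a t = 0 := by
  rw [← restrict_Ioo_eq_restrict_Icc, ae_restrict_iff' measurableSet_Ioo]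
  filter_upwards [ha.ae_hasDerivAt_integral] with t ht htT
  have htm : t ∈ uIcc 0 T := by rw [uIcc_of_le hT.le]; exact Ioo_subset_Icc_self htT
  refine (ht htm 0 left_mem_uIcc).unique ?_
  refine (hasDerivAt_const t (0:ℝ)).congr_of_eventuallyEq ?_
  filter_upwards [Ioo_mem_nhds htT.1 htT.2] with s hs using h s (Ioo_subset_Icc_self hs)

theorem lipschitzOnWith_integral {E : Type*} [NormedAddCommGroup E] [NormedSpace ℝ E]
    {a : ℝ → E} {T R : ℝ} (hT : 0 ≤ T) (hR : 0 ≤ R) (ha : IntervalIntegrable a volume 0 T)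
    (haR : ∀ t ∈ Icc 0 T, ‖a t‖ ≤ R) :
    LipschitzOnWith R.toNNReal (fun t => ∫ s in (0:ℝ)..t, a s) (Icc 0 T) := by
  refine LipschitzOnWith.of_dist_le_mul fun s hs t ht => ?_
  have hsub : ∀ t ∈ Icc 0 T, IntervalIntegrable a volume 0 t := fun t ht =>
    ha.mono_set (by rw [uIcc_of_le ht.1, uIcc_of_le hT]; exact Icc_subset_Icc_right ht.2)
  rw [dist_eq_norm, intervalIntegral.integral_interval_sub_left (hsub s hs) (hsub t ht),
    Real.coe_toNNReal _ hR, Real.dist_eq]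
  exact intervalIntegral.norm_integral_le_of_norm_le_const fun x hx =>
    haR x (uIcc_subset_Icc ht hs (uIoc_subset_uIcc hx))

/-- Fundamental theorem of calculus for a `C¹` function along a trajectory with bounded velocity. -/
theorem comp_eq_add_integral_fderiv {E G : Type*} [NormedAddCommGroup E] [NormedSpace ℝ E]
    [CompleteSpace E] [NormedAddCommGroup G] [NormedSpace ℝ G] [CompleteSpace G]
    {φ : E → G} {V K : Set E} (hV : IsOpen V) (hKV : K ⊆ V) (hK : IsCompact K)
    (hφ : ContDiffOn ℝ 1 φ V) {y v : ℝ → E} {T M : ℝ} (hT : 0 ≤ T)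
    (hyK : ∀ t ∈ Icc 0 T, y t ∈ K) (hv : IntervalIntegrable v volume 0 T)
    (hvM : ∀ t ∈ Icc 0 T, ‖v t‖ ≤ M)
    (hy : ∀ t ∈ Icc 0 T, y t = y 0 + ∫ s in (0:ℝ)..t, v s)
    (hφv : IntervalIntegrable (fun s => fderiv ℝ φ (y s) (v s)) volume 0 T) :
    φ (y T) = φ (y 0) + ∫ s in (0:ℝ)..T, fderiv ℝ φ (y s) (v s) := by
  have hM : 0 ≤ M := (norm_nonneg _).trans (hvM 0 ⟨le_rfl, hT⟩)
  have hyL : LipschitzOnWith M.toNNReal y (Icc 0 T) := by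
    have := lipschitzOnWith_integral hT hM hv hvM
    intro s hs t ht
    rw [hy s hs, hy t ht, edist_add_left]
    exact this hs ht
  obtain ⟨L, hL⟩ : ∃ L, LipschitzOnWith L φ K := by
    refine LocallyLipschitzOn.exists_lipschitzOnWith_of_compact hK fun x hx => ?_
    obtain ⟨L, t, ht, hLt⟩ := (hφ.contDiffAt (hV.mem_nhds (hKV hx))).exists_lipschitzOnWith
    exact ⟨L, t, mem_nhdsWithin_of_mem_nhds ht, hLt⟩
  obtain ⟨N, hN⟩ : ∃ N, ∀ x ∈ K, ‖fderiv ℝ φ x‖ ≤ N :=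
    hK.exists_bound_of_continuousOn ((hφ.continuousOn_fderiv_of_isOpen hV le_rfl).mono hKV)
  have hN0 : 0 ≤ N := (norm_nonneg _).trans (hN _ (hyK 0 ⟨le_rfl, hT⟩))
  have h1 : AbsolutelyContinuousOnInterval (fun t => φ (y t)) 0 T := by
    refine LipschitzOnWith.absolutelyContinuousOnInterval (K := L * M.toNNReal) ?_
    rw [uIcc_of_le hT]
    exact hL.comp hyL hyK
  have h2 : AbsolutelyContinuousOnInterval
      (fun t => ∫ s in (0:ℝ)..t, fderiv ℝ φ (y s) (v s)) 0 T := by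
    refine LipschitzOnWith.absolutelyContinuousOnInterval (K := (N * M).toNNReal) ?_
    rw [uIcc_of_le hT]
    refine lipschitzOnWith_integral hT (by positivity) hφv fun t ht => ?_
    exact ((fderiv ℝ φ (y t)).le_opNorm _).trans
      (mul_le_mul (hN _ (hyK t ht)) (hvM t ht) (norm_nonneg _) hN0)
  obtain ⟨c, hc⟩ := (h1.sub h2).const_of_ae_hasDerivAt_zero (by
    filter_upwards [hv.ae_hasDerivAt_integral, hφv.ae_hasDerivAt_integral,
      Measure.ae_ne volume 0, Measure.ae_ne volume T] with t hv' hφ' h0 hT' ht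
    have htI : t ∈ Icc 0 T := by rwa [uIcc_of_le hT] at ht
    have d1 : HasDerivAt y (v t) t := by
      refine ((hv' ht 0 left_mem_uIcc).const_add (y 0)).congr_of_eventuallyEq ?_
      filter_upwards [Ioo_mem_nhds (lt_of_le_of_ne htI.1 h0.symm) (lt_of_le_of_ne htI.2 hT')]
        with s hs using hy s (Ioo_subset_Icc_self hs)
    have d2 : HasFDerivAt φ (fderiv ℝ φ (y t)) (y t) :=
      ((hφ.contDiffAt (hV.mem_nhds (hKV (hyK t htI)))).differentiableAt one_ne_zero).hasFDerivAt
    have d3 := (d2.comp_hasDerivAt t d1).sub (hφ' ht 0 left_mem_uIcc)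
    rw [sub_self] at d3
    exact d3)
  have e0 := hc 0 left_mem_uIcc
  have eT := hc T right_mem_uIcc
  simp only [Pi.sub_apply, intervalIntegral.integral_same, sub_zero] at e0 eT
  rw [e0, ← eT]
  abel

/-- For uniformly Lipschitz functions on a compact interval, pointwise convergence is uniform. -/
theorem tendstoUniformlyOn_of_lipschitzOnWith {E ι : Type*} [PseudoMetricSpace E] {l : Filter ι}
    {z : ι → ℝ → E} {z₀ : ℝ → E} {S : Set ℝ} {K : ℝ≥0} (hS : IsCompact S)
    (hz : ∀ i, LipschitzOnWith K (z i) S)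
    (h : ∀ t ∈ S, Tendsto (fun i => z i t) l (𝓝 (z₀ t))) : TendstoUniformlyOn z z₀ l S := by
  have := isCompact_iff_compactSpace.1 hS
  rw [tendstoUniformlyOn_iff_tendstoUniformly_comp_coe]
  have heq : Equicontinuous fun i => z i ∘ ((↑) : S → ℝ) :=
    (LipschitzWith.uniformEquicontinuous _ K fun i => (hz i).to_restrict).equicontinuous
  exact UniformFun.tendsto_iff_tendstoUniformly.1
    ((heq.tendsto_uniformFun_iff_pi l (z₀ ∘ (↑))).2 (tendsto_pi_nhds.2 fun t => h t t.2))

/-- A solution on `[0, T]` whose endpoint lies in a viable set extends to a global one. -/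
theorem exists_averagedSol_extension {d m k : ℕ} {U : Set (Dd d)} {f g : Dd d → Em m → Em m}
    {F : Em m → Kk k} {Z : Set (Kk k)} (hV : AveragedViable U f F g Z) {T : ℝ} (hT : 0 < T)
    {κ : ℝ → Measure (Dd d × Em m)} {z : ℝ → Kk k} {z₀ : Kk k}
    (hint : IntervalIntegrable (fun s => htilde F g (κ s)) volume 0 T)
    (hz : ∀ t ∈ Icc 0 T, z t = z₀ + ∫ s in (0:ℝ)..t, htilde F g (κ s))
    (hzZ : ∀ t ∈ Icc 0 T, z t ∈ Z)
    (hW : ∀ᵐ t ∂(volume.restrict (Icc 0 T)), κ t ∈ W U f F (z t)) :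
    ∃ μt zf, IsAveragedSol U f F g z₀ μt zf ∧ (∀ t : ℝ, 0 ≤ t → zf t ∈ Z) ∧
      EqOn zf z (Icc 0 T) ∧ ∀ᵐ t, t ∈ Icc 0 T → μt t = κ t := by
  classical
  have hne : ∀ z ∈ Z, ∃ ν, ν ∈ W U f F z := fun z hz => by
    obtain ⟨μt, zf, h, -⟩ := hV z hz
    exact ⟨μt 0, h.1 ▸ h.2.2.2.2 0 le_rfl⟩
  choose! ν hν using hne
  obtain ⟨μ₂, z₂, ⟨h20, -, h2i, h2z, h2W⟩, h2Z⟩ := hV (z T) (hzZ T ⟨hT.le, le_rfl⟩)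
  let μt : ℝ → Measure (Dd d × Em m) := fun t =>
    if t < 0 then 0 else if t ≤ T then (if κ t ∈ W U f F (z t) then κ t else ν (z t))
      else μ₂ (t - T)
  let zf : ℝ → Kk k := fun t => if t ≤ T then z t else z₂ (t - T)
  have hμκ : ∀ᵐ t, t ∈ Icc 0 T → μt t = κ t := by
    filter_upwards [(ae_restrict_iff' measurableSet_Icc).1 hW] with t ht htT
    simp [μt, not_lt.2 htT.1, htT.2, ht htT]
  have hneg : ∀ t < 0, htilde F g (μt t) = 0 := fun t ht => by
    simp [μt, ht, htilde]
  have hpos : ∀ t, T < t → htilde F g (μt t) = htilde F g (μ₂ (t - T)) := fun t ht => by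
    simp [μt, not_le.2 ht, not_lt.2 (hT.le.trans ht.le)]
  have i1 : IntervalIntegrable (fun s => htilde F g (μt s)) volume 0 T := by
    refine hint.congr_ae ?_
    rw [uIoc_of_le hT.le, Filter.EventuallyEq, ae_restrict_iff' measurableSet_Ioc]
    filter_upwards [hμκ] with t ht htT
    rw [ht (Ioc_subset_Icc_self htT)]
  have i1' : ∀ t ∈ Icc 0 T, ∫ s in (0:ℝ)..t, htilde F g (μt s) =
      ∫ s in (0:ℝ)..t, htilde F g (κ s) := fun t ht => by
    refine intervalIntegral.integral_congr_ae ?_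
    filter_upwards [hμκ] with s hs hst
    rw [uIoc_of_le ht.1] at hst
    rw [hs ⟨hst.1.le, hst.2.trans ht.2⟩]
  have i2 : ∀ S, T ≤ S → IntervalIntegrable (fun s => htilde F g (μt s)) volume T S := by
    intro S hS
    have := (h2i (S - T)).comp_sub_right T
    rw [zero_add, sub_add_cancel] at this
    refine this.congr_uIoo fun t ht => ?_
    rw [uIoo_of_le hS] at ht
    exact (hpos t ht.1).symm
  have i2' : ∀ S, T ≤ S → ∫ s in T..S, htilde F g (μt s) =
      ∫ s in (0:ℝ)..(S - T), htilde F g (μ₂ s) := by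
    intro S hS
    have := intervalIntegral.integral_comp_sub_right (a := T) (b := S)
      (fun s => htilde F g (μ₂ s)) T
    rw [sub_self] at this
    rw [← this]
    refine intervalIntegral.integral_congr_uIoo fun t ht => ?_
    rw [uIoo_of_le hS] at ht
    exact hpos t ht.1
  have i3 : ∀ S, IntervalIntegrable (fun s => htilde F g (μt s)) volume 0 S := by
    intro S
    rcases le_total S 0 with h | h
    · refine (IntervalIntegrable.zero (μ := volume) (a := 0) (b := S)).congr_uIoo fun t ht => ?_
      rw [uIoo_of_ge h] at ht
      exact (hneg t ht.2).symm
    · rcases le_total S T with h' | h'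
      · refine i1.mono_set ?_
        rw [uIcc_of_le h, uIcc_of_le hT.le]
        exact Icc_subset_Icc_right h'
      · exact i1.trans (i2 S h')
  have hzf : ∀ t, 0 ≤ t → zf t = z₀ + ∫ s in (0:ℝ)..t, htilde F g (μt s) := by
    intro t ht
    rcases le_or_gt t T with h | h
    · simp only [zf, if_pos h]
      rw [i1' t ⟨ht, h⟩, hz t ⟨ht, h⟩]
    · simp only [zf, if_neg (not_le.2 h)]
      rw [← intervalIntegral.integral_add_adjacent_intervals i1 (i2 t h.le), i2' t h.le,
        h2z (t - T) (by linarith), hz T ⟨hT.le, le_rfl⟩, i1' T ⟨hT.le, le_rfl⟩, add_assoc]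
  refine ⟨μt, zf, ⟨?_, ?_, i3, hzf, fun t ht => ?_⟩, fun t ht => ?_, fun t ht => ?_, hμκ⟩
  · simpa using hzf 0 le_rfl
  · refine ContinuousOn.congr (continuousOn_const.add ?_) hzf
    refine (intervalIntegral.continuous_primitive (fun a b => ?_) 0).continuousOn
    exact (i3 a).symm.trans (i3 b)
  · rcases le_or_gt t T with h | h
    · simp only [zf, μt, if_pos h, if_neg (not_lt.2 ht)]
      split_ifs with h'
      · exact h'
      · exact hν _ (hzZ t ⟨ht, h⟩)
    · simp only [zf, μt, if_neg (not_le.2 h), if_neg (not_lt.2 ht)]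
      exact h2W _ (by linarith)
  · rcases le_or_gt t T with h | h
    · simp only [zf, if_pos h]
      exact hzZ t ⟨ht, h⟩
    · simp only [zf, if_neg (not_le.2 h)]
      exact h2Z _ (by linarith)
  · simp [zf, ht.2]

/-- A control and a trajectory staying in a set combine to a measurable path in the product. -/
theorem exists_measurable_path {d m : ℕ} {U : Set (Dd d)} {Y : Set (Em m)} {u : ℝ → Dd d}
    {y : ℝ → Em m} (hu : IsControl U u) (hyc : ContinuousOn y (Ici 0))
    (hy : ∀ t : ℝ, 0 ≤ t → y t ∈ Y) :
    ∃ w : ℝ → ↥(U ×ˢ Y), Measurable w ∧ ∀ t, 0 ≤ t → (w t : Dd d × Em m) = (u t, y t) := by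
  refine ⟨fun t => ⟨(u (max t 0), y (max t 0)),
    hu.2 _ (le_max_right _ _), hy _ (le_max_right _ _)⟩, ?_, fun t ht => by simp [ht]⟩
  have h1 : Measurable fun t : ℝ => max t 0 := by fun_prop
  have h2 : Continuous fun t : ℝ => y (max t 0) :=
    hyc.comp_continuous (by fun_prop) fun t => le_max_right t 0
  exact ((hu.1.comp h1).prodMk h2.measurable).subtype_mk

/-- Chain rule in integral form along solutions of the perturbed system. -/
theorem IsSolOn.comp_eq_add_integral {d m : ℕ} {G : Type*} [NormedAddCommGroup G]
    [NormedSpace ℝ G] [FiniteDimensional ℝ G] {U : Set (Dd d)} {Y V : Set (Em m)}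
    {vf : Dd d → Em m → Em m} {u : ℝ → Dd d} {y : ℝ → Em m}
    (hU : IsCompact U) (hY : IsCompact Y) (hvf : Continuous fun p : Dd d × Em m => vf p.1 p.2)
    (hsol : IsSolOn (fun s x => vf (u s) x) y) {w : ℝ → ↥(U ×ˢ Y)} (hw : Measurable w)
    (hwt : ∀ t, 0 ≤ t → (w t : Dd d × Em m) = (u t, y t))
    {φ : Em m → G} (hV : IsOpen V) (hYV : Y ⊆ V) (hφ : ContDiffOn ℝ 1 φ V) {t : ℝ} (ht : 0 ≤ t) :
    φ (y t) = φ (y 0) +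
      ∫ s in (0:ℝ)..t, fderiv ℝ φ (w s).1.2 (vf (w s).1.1 (w s).1.2) := by
  have := isCompact_iff_compactSpace.1 (hU.prod hY)
  have := FiniteDimensional.complete ℝ G
  have hmem : ∀ t, 0 ≤ t → u t ∈ U ∧ y t ∈ Y := fun t ht => by
    have := (w t).2
    rw [hwt t ht] at this
    exact this
  have hvc : Continuous fun p : ↥(U ×ˢ Y) => vf p.1.1 p.1.2 := hvf.comp continuous_subtype_val
  obtain ⟨M, hM⟩ := isCompact_univ.exists_bound_of_continuousOn hvc.continuousOn
  have hqc : Continuous fun p : ↥(U ×ˢ Y) => fderiv ℝ φ p.1.2 (vf p.1.1 p.1.2) := by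
    refine Continuous.clm_apply ?_ hvc
    exact (hφ.continuousOn_fderiv_of_isOpen hV le_rfl).comp_continuous (by fun_prop)
      fun p => hYV p.2.2
  obtain ⟨N, hN⟩ := isCompact_univ.exists_bound_of_continuousOn hqc.continuousOn
  have hcongr : ∀ s ∈ Icc 0 t, fderiv ℝ φ (w s).1.2 (vf (w s).1.1 (w s).1.2) =
      fderiv ℝ φ (y s) (vf (u s) (y s)) := fun s hs => by rw [hwt s hs.1]
  have hii : IntervalIntegrable
      (fun s => fderiv ℝ φ (w s).1.2 (vf (w s).1.1 (w s).1.2)) volume 0 t := by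
    refine (intervalIntegrable_const (c := N)).mono_fun ?_
      (ae_of_all _ fun s => (hN (w s) (mem_univ _)).trans (le_abs_self N))
    exact (hqc.stronglyMeasurable.comp_measurable hw).aestronglyMeasurable
  rw [intervalIntegral.integral_congr (g := fun s => fderiv ℝ φ (y s) (vf (u s) (y s)))
    fun s hs => hcongr s (by rwa [uIcc_of_le ht] at hs)]
  refine comp_eq_add_integral_fderiv hV hYV hY hφ (M := M) ht (fun s hs => (hmem s hs.1).2)
    (hsol.2.1 t) (fun s hs => ?_) (fun s hs => hsol.2.2 s hs.1)
    (hii.congr_uIoo fun s hs => hcongr s ?_)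
  · simpa [hwt s hs.1] using hM (w s) (mem_univ _)
  · rw [uIoo_of_le ht] at hs
    exact Ioo_subset_Icc_self hs

/-- Limits of perturbed trajectories along an ultrafilter with `ε → 0` are solutions of the averaged
system on `[0, T]`. -/
theorem exists_averaged_limit {d m k : ℕ} {U : Set (Dd d)} {Y : Set (Em m)}
    {Zc : Set (Kk k)} {f g : Dd d → Em m → Em m} {F : Em m → Kk k} {r : Dd d → Em m → ℝ}
    (C : ℝ) {y₀ : Em m} (hU : IsCompact U) (hY : IsCompact Y) (hZc : IsCompact Zc)
    (hfC : Continuous fun p : Dd d × Em m => f p.1 p.2)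
    (hgC : Continuous fun p : Dd d × Em m => g p.1 p.2)
    (hrC : Continuous fun p : Dd d × Em m => r p.1 p.2)
    {V : Set (Em m)} (hV : IsOpen V) (hYV : Y ⊆ V) (hF : ContDiffOn ℝ 1 F V)
    (hInv : ∀ u ∈ U, ∀ y ∈ Y, fderiv ℝ F y (f u y) = 0) {T : ℝ} (hT : 0 < T)
    {ι : Type*} (𝒰 : Ultrafilter ι) {e : ι → ℝ} (he0 : ∀ i, 0 < e i)
    (he : Tendsto e 𝒰 (𝓝 0)) {u : ι → ℝ → Dd d} {y : ι → ℝ → Em m}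
    (hu : ∀ i, IsControl U (u i))
    (hsol : ∀ i, IsSolOn (fun s x => (e i)⁻¹ • f (u i s) x + g (u i s) x) (y i))
    (hy0 : ∀ i, y i 0 = y₀) (hyY : ∀ i, ∀ t : ℝ, 0 ≤ t → y i t ∈ Y ∧ F (y i t) ∈ Zc) :
    ∃ (κ : ℝ → Measure (Dd d × Em m)) (z : ℝ → Kk k),
      IntervalIntegrable (fun s => htilde F g (κ s)) volume 0 T ∧
      (∀ t ∈ Icc 0 T, z t = F y₀ + ∫ s in (0:ℝ)..t, htilde F g (κ s)) ∧
      (∀ t ∈ Icc 0 T, z t ∈ Zc) ∧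
      (∀ᵐ t ∂(volume.restrict (Icc 0 T)), κ t ∈ W U f F (z t)) ∧
      TendstoUniformlyOn (fun i t => F (y i t)) z 𝒰 (Icc 0 T) ∧
      Tendsto (fun i => ∫ t in (0:ℝ)..T, Real.exp (-C * t) * r (u i t) (y i t)) 𝒰
        (𝓝 (∫ t in (0:ℝ)..T, Real.exp (-C * t) * rtilde r (κ t))) := by
  have hAc : IsCompact (U ×ˢ Y) := hU.prod hY
  have := isCompact_iff_compactSpace.1 hAc
  have bounded : ∀ {E : Type} [NormedAddCommGroup E] {q : ↥(U ×ˢ Y) → E}, Continuous q →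
      ∃ M, 0 ≤ M ∧ ∀ p, ‖q p‖ ≤ M := fun {E} _ {q} hq => by
    obtain ⟨M, hM⟩ := isCompact_univ.exists_bound_of_continuousOn hq.continuousOn
    exact ⟨max M 0, le_max_right _ _, fun p => (hM p (mem_univ p)).trans (le_max_left _ _)⟩
  obtain ⟨i₀⟩ : Nonempty ι := nonempty_of_neBot (𝒰 : Filter ι)
  choose w hw hwt using fun i => exists_measurable_path (hu i) (hsol i).1 fun t ht => (hyY i t ht).1
  have : Nonempty ↥(U ×ˢ Y) := ⟨w i₀ 0⟩
  obtain ⟨κ, hκP, hκ⟩ := exists_kernel_tendsto_integral 𝒰 hT w hw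
  have hAm : MeasurableSet (U ×ˢ Y) := hAc.isClosed.measurableSet
  have hmap : ∀ {E : Type} [NormedAddCommGroup E] [NormedSpace ℝ E] (q : Dd d × Em m → E) t,
      ∫ p, q p ∂((κ t).map Subtype.val) = ∫ p, q p.1 ∂κ t := fun q t =>
    (MeasurableEmbedding.subtype_coe hAm).integral_map q
  have chain : ∀ {G : Type} [NormedAddCommGroup G] [NormedSpace ℝ G] [FiniteDimensional ℝ G]
      {φ : Em m → G} {V : Set (Em m)}, IsOpen V → Y ⊆ V → ContDiffOn ℝ 1 φ V → ∀ i t, 0 ≤ t →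
      φ (y i t) = φ y₀ + ∫ s in (0:ℝ)..t, fderiv ℝ φ (w i s).1.2
        ((e i)⁻¹ • f (w i s).1.1 (w i s).1.2 + g (w i s).1.1 (w i s).1.2) := by
    intro G _ _ _ φ V hV hYV hφ i t ht
    rw [IsSolOn.comp_eq_add_integral hU hY (vf := fun u x => (e i)⁻¹ • f u x + g u x)
      (by fun_prop) (hsol i) (hw i) (hwt i) hV hYV hφ ht, hy0]
  have hgc : Continuous fun p : ↥(U ×ˢ Y) => g p.1.1 p.1.2 := hgC.comp continuous_subtype_val
  have hfc : Continuous fun p : ↥(U ×ˢ Y) => f p.1.1 p.1.2 := hfC.comp continuous_subtype_val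
  have hFc : Continuous fun p : ↥(U ×ˢ Y) => F p.1.2 :=
    hF.continuousOn.comp_continuous (by fun_prop) fun p => hYV p.2.2
  have hhc : Continuous fun p : ↥(U ×ˢ Y) => hObs F g p.1 :=
    Continuous.clm_apply ((hF.continuousOn_fderiv_of_isOpen hV le_rfl).comp_continuous
      (by fun_prop) fun p => hYV p.2.2) hgc
  have hii : ∀ {E : Type} [NormedAddCommGroup E] [NormedSpace ℝ E] [SecondCountableTopology E]
      {q : ↥(U ×ˢ Y) → E}, Continuous q →
      ∀ a b, IntervalIntegrable (fun t => ∫ p, q p ∂κ t) volume a b := by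
    intro E _ _ _ q hq a b
    obtain ⟨M, hM0, hM⟩ := bounded hq
    refine (intervalIntegrable_const (c := M)).mono_fun
      (StronglyMeasurable.integral_kernel hq.stronglyMeasurable).aestronglyMeasurable
      (ae_of_all _ fun t => ?_)
    rw [Real.norm_of_nonneg hM0]
    simpa using norm_integral_le_of_norm_le_const (μ := κ t) (ae_of_all _ hM)
  have hiw : ∀ {E : Type} [NormedAddCommGroup E] [NormedSpace ℝ E] [SecondCountableTopology E]
      {q : ↥(U ×ˢ Y) → E}, Continuous q →
      ∀ i a b, IntervalIntegrable (fun t => q (w i t)) volume a b := by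
    intro E _ _ _ q hq i a b
    obtain ⟨M, hM0, hM⟩ := bounded hq
    refine (intervalIntegrable_const (c := M)).mono_fun
      (hq.stronglyMeasurable.comp_measurable (hw i)).aestronglyMeasurable
      (ae_of_all _ fun t => ?_)
    rw [Real.norm_of_nonneg hM0]
    exact hM _
  let z : ℝ → Kk k := fun t => F y₀ + ∫ s in (0:ℝ)..t, ∫ p, hObs F g p.1 ∂κ s
  have hzc : Continuous z := continuous_const.add
    (intervalIntegral.continuous_primitive (hii hhc) 0)
  have hslow : ∀ i t, 0 ≤ t → F (y i t) = F y₀ + ∫ s in (0:ℝ)..t, hObs F g (w i s).1 := by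
    intro i t ht
    rw [chain hV hYV hF i t ht]
    congr 1
    refine intervalIntegral.integral_congr fun s _ => ?_
    simp [hObs, hInv _ (w i s).2.1 _ (w i s).2.2]
  have hptw : ∀ t ∈ Icc 0 T, Tendsto (fun i => F (y i t)) 𝒰 (𝓝 (z t)) := by
    intro t ht
    simp only [hslow _ t ht.1]
    exact (tendsto_euclidean_integral_cut hw hκ hhc ht).const_add _
  have hunif : TendstoUniformlyOn (fun i t => F (y i t)) z 𝒰 (Icc 0 T) := by
    obtain ⟨M, hM0, hM⟩ := bounded hhc
    refine tendstoUniformlyOn_of_lipschitzOnWith (K := M.toNNReal) isCompact_Icc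
      (fun i s hs t ht => ?_) hptw
    simp only [hslow i s hs.1, hslow i t ht.1, edist_add_left]
    exact lipschitzOnWith_integral hT.le hM0 (hiw hhc i 0 T) (fun t _ => hM _) hs ht
  have hsupp : ∀ᵐ t ∂(volume.restrict (Icc 0 T)), ∀ᵐ p ∂κ t, F p.1.2 = z t := by
    have hGc : Continuous fun p : ℝ × ↥(U ×ˢ Y) => ‖F p.2.1.2 - z p.1‖ :=
      ((hFc.comp continuous_snd).sub (hzc.comp continuous_fst)).norm
    have h0 : Tendsto (fun i => ∫ t in (0:ℝ)..T, ‖F (w i t).1.2 - z t‖) 𝒰 (𝓝 0) := by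
      rw [Metric.tendsto_nhds]
      intro η hη
      filter_upwards [Metric.tendstoUniformlyOn_iff.1 hunif (η / (2 * T)) (by positivity)] with i hi
      have := intervalIntegral.norm_integral_le_of_norm_le_const (a := 0) (b := T)
        (f := fun t => ‖F (w i t).1.2 - z t‖) (C := η / (2 * T)) fun t ht => by
          rw [uIoc_of_le hT.le] at ht
          have h := hi t (Ioc_subset_Icc_self ht)
          rw [norm_norm, hwt i t ht.1.le, ← dist_eq_norm, dist_comm]
          exact h.le
      rw [dist_zero_right]
      refine this.trans_lt ?_
      rw [sub_zero, abs_of_pos hT]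
      field_simp
      linarith
    have h1 := tendsto_nhds_unique (hκ _ hGc) h0
    have hGi : ∀ t, Integrable (fun p => ‖F p.1.2 - z t‖) (κ t) := fun t =>
      (hFc.sub continuous_const).norm.integrable_of_hasCompactSupport
        (HasCompactSupport.of_compactSpace _)
    have hm : Measurable fun t => ∫ p, ‖F p.1.2 - z t‖ ∂κ t :=
      (StronglyMeasurable.integral_kernel_prod_right' hGc.stronglyMeasurable).measurable
    have hmi : IntervalIntegrable (fun t => ∫ p, ‖F p.1.2 - z t‖ ∂κ t) volume 0 T := by
      obtain ⟨M, hM0, hM⟩ := bounded hFc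
      obtain ⟨N, hN⟩ := (isCompact_Icc (a := (0:ℝ)) (b := T)).exists_bound_of_continuousOn
        hzc.continuousOn
      rw [intervalIntegrable_iff_integrableOn_Icc_of_le hT.le]
      refine Integrable.of_bound (C := M + N) hm.aestronglyMeasurable ?_
      rw [ae_restrict_iff' measurableSet_Icc]
      refine ae_of_all _ fun t ht => ?_
      have : ∀ p : ↥(U ×ˢ Y), ‖‖F p.1.2 - z t‖‖ ≤ M + N := fun p => by
        rw [norm_norm]
        exact (norm_sub_le _ _).trans (add_le_add (hM p) (hN t ht))
      simpa using norm_integral_le_of_norm_le_const (μ := κ t) (ae_of_all _ this)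
    have h2 : ∀ᵐ t ∂(volume.restrict (Icc 0 T)), ∫ p, ‖F p.1.2 - z t‖ ∂κ t = 0 := by
      rw [intervalIntegral.integral_of_le hT.le, ← integral_Icc_eq_integral_Ioc,
        integral_eq_zero_iff_of_nonneg (fun t => integral_nonneg fun p => norm_nonneg _)
        ((intervalIntegrable_iff_integrableOn_Icc_of_le hT.le).1 hmi)] at h1
      exact h1
    filter_upwards [h2] with t ht
    rw [integral_eq_zero_iff_of_nonneg (fun p => norm_nonneg _) (hGi t)] at ht
    filter_upwards [ht] with p hp
    exact sub_eq_zero.1 (norm_eq_zero.1 hp)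
  have hφfc : ∀ φ : Em m → ℝ, ContDiff ℝ 1 φ →
      Continuous fun p : ↥(U ×ˢ Y) => fderiv ℝ φ p.1.2 (f p.1.1 p.1.2) := fun φ hφ =>
    ((hφ.continuous_fderiv one_ne_zero).comp (by fun_prop)).clm_apply hfc
  have hφgc : ∀ φ : Em m → ℝ, ContDiff ℝ 1 φ →
      Continuous fun p : ↥(U ×ˢ Y) => fderiv ℝ φ p.1.2 (g p.1.1 p.1.2) := fun φ hφ =>
    ((hφ.continuous_fderiv one_ne_zero).comp (by fun_prop)).clm_apply hgc
  have hφ0 : ∀ φ : Em m → ℝ, ContDiff ℝ 1 φ → ∀ s ∈ Icc 0 T,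
      ∫ t in (0:ℝ)..s, ∫ p, fderiv ℝ φ p.1.2 (f p.1.1 p.1.2) ∂κ t = 0 := by
    intro φ hφ s hs
    refine tendsto_nhds_unique (tendsto_integral_cut hw hκ (hφfc φ hφ) hs) ?_
    obtain ⟨M, hM0, hM⟩ := bounded (hφgc φ hφ)
    obtain ⟨N, hN⟩ := hY.exists_bound_of_continuousOn hφ.continuous.continuousOn
    have hid : ∀ i, ∫ t in (0:ℝ)..s, fderiv ℝ φ (w i t).1.2 (f (w i t).1.1 (w i t).1.2) =
        e i * (φ (y i s) - φ y₀ -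
          ∫ t in (0:ℝ)..s, fderiv ℝ φ (w i t).1.2 (g (w i t).1.1 (w i t).1.2)) := by
      intro i
      have h := chain isOpen_univ (subset_univ Y) hφ.contDiffOn i s hs.1
      simp only [map_add, map_smul, smul_eq_mul] at h
      rw [intervalIntegral.integral_add ((hiw (hφfc φ hφ) i 0 s).const_mul _)
        (hiw (hφgc φ hφ) i 0 s), intervalIntegral.integral_const_mul] at h
      have := (he0 i).ne'
      rw [h]
      field_simp
      ring
    simp only [hid]
    refine he.zero_mul_isBoundedUnder_le (isBoundedUnder_of ⟨N + N + M * T, fun i => ?_⟩)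
    have h1 := intervalIntegral.norm_integral_le_of_norm_le_const (a := 0) (b := s)
      (f := fun t => fderiv ℝ φ (w i t).1.2 (g (w i t).1.1 (w i t).1.2)) fun t _ => hM _
    rw [sub_zero, abs_of_nonneg hs.1] at h1
    have h2 := hN _ (hyY i s hs.1).1
    have h3 := hN _ (hyY i 0 le_rfl).1
    rw [hy0] at h3
    refine (norm_sub_le _ _).trans (add_le_add ((norm_sub_le _ _).trans (add_le_add h2 h3)) ?_)
    exact h1.trans (mul_le_mul_of_nonneg_left hs.2 hM0)
  have hinv := ae_forall_integral_eq_zero (κ := κ) (μ := volume.restrict (Icc 0 T))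
    {q : C(↥(U ×ˢ Y), ℝ) | ∃ φ : Em m → ℝ, ContDiff ℝ 1 φ ∧
      ∀ p, q p = fderiv ℝ φ p.1.2 (f p.1.1 p.1.2)} (by
    rintro q ⟨φ, hφ, hq⟩
    simp only [hq]
    exact ae_eq_zero_of_integral_eq_zero hT (hii (hφfc φ hφ) 0 T) (hφ0 φ hφ))
  refine ⟨fun t => (κ t).map Subtype.val, z, ?_, fun t _ => ?_, fun t ht => ?_, ?_, hunif, ?_⟩
  · simp only [htilde, hmap]
    exact hii hhc 0 T
  · simp only [htilde, hmap, z]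
  · exact hZc.isClosed.mem_of_tendsto (hptw t ht)
      (Eventually.of_forall fun i => (hyY i t ht.1).2)
  · filter_upwards [hsupp, hinv] with t ht1 ht2
    have hP : IsProbabilityMeasure ((κ t).map (Subtype.val : ↥(U ×ˢ Y) → Dd d × Em m)) :=
      Measure.isProbabilityMeasure_map measurable_subtype_coe.aemeasurable
    refine ⟨hP, ?_, fun φ hφ => ?_⟩
    · rw [(MeasurableEmbedding.subtype_coe hAm).map_apply, ← measure_univ (μ := κ t)]
      refine measure_congr ?_
      filter_upwards [ht1] with p hp
      exact propext ⟨fun _ => trivial, fun _ => ⟨p.2.1, hp⟩⟩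
    · rw [hmap]
      exact ht2 ⟨_, hφfc φ hφ⟩ ⟨φ, hφ, fun _ => rfl⟩
  · have hGc : Continuous fun p : ℝ × ↥(U ×ˢ Y) => Real.exp (-C * p.1) * r p.2.1.1 p.2.1.2 :=
      (by fun_prop : Continuous fun p : ℝ × ↥(U ×ˢ Y) => Real.exp (-C * p.1)).mul
        (hrC.comp (continuous_subtype_val.comp continuous_snd))
    have h := hκ _ hGc
    simp only [integral_const_mul] at h
    simp only [rtilde, hmap]
    refine h.congr fun i => intervalIntegral.integral_congr fun t ht => ?_
    rw [uIcc_of_le hT.le] at ht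
    simp only [hwt i t ht.1]

/-- A property that holds at every scale for some tolerance, and eventually for each positive
tolerance, holds with a tolerance tending to zero. -/
theorem exists_tendsto_zero_of_eventually {P : ℝ → ℝ → Prop}
    (hmono : ∀ ε a b, a ≤ b → P ε a → P ε b) {M : ℝ} (hM : ∀ ε > 0, P ε M)
    (hP : ∀ δ > 0, ∀ᶠ ε in 𝓝[>] (0:ℝ), P ε δ) :
    ∃ β : ℝ → ℝ, Tendsto β (𝓝[>] (0:ℝ)) (𝓝 0) ∧ ∀ ε > 0, P ε (β ε) := by
  have hbdd : ∀ ε, BddBelow {b | 0 ≤ b ∧ P ε b} := fun ε => ⟨0, fun b hb => hb.1⟩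
  have hid : Tendsto (fun ε : ℝ => ε) (𝓝[>] 0) (𝓝 0) := nhdsWithin_le_nhds
  refine ⟨fun ε => sInf {b | 0 ≤ b ∧ P ε b} + ε, ?_, fun ε hε => ?_⟩
  · suffices h : Tendsto (fun ε => sInf {b | 0 ≤ b ∧ P ε b}) (𝓝[>] 0) (𝓝 0) by
      simpa using h.add hid
    rw [Metric.tendsto_nhds]
    intro δ hδ
    filter_upwards [hP (δ / 2) (half_pos hδ)] with ε h
    rw [Real.dist_0_eq_abs, abs_of_nonneg (Real.sInf_nonneg fun b hb => hb.1)]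
    exact (csInf_le (hbdd ε) ⟨(half_pos hδ).le, h⟩).trans_lt (half_lt_self hδ)
  · obtain ⟨b, hb, hlt⟩ := exists_lt_of_csInf_lt
      (s := {b | 0 ≤ b ∧ P ε b})
      ⟨max M 0, le_max_right _ _, hmono ε _ _ (le_max_left _ _) (hM ε hε)⟩
      (lt_add_of_pos_right (sInf {b | 0 ≤ b ∧ P ε b}) hε)
    exact hmono ε b _ hlt.le hb.2

theorem abs_rtilde_le {d m k : ℕ} {U : Set (Dd d)} {Y : Set (Em m)} {f : Dd d → Em m → Em m}
    {F : Em m → Kk k} {r : Dd d → Em m → ℝ} {z : Kk k} {μ : Measure (Dd d × Em m)} {R : ℝ}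
    (hU : IsCompact U) (hY : IsCompact Y) (hzY : lvl F z ⊆ Y)
    (hR : ∀ u ∈ U, ∀ y ∈ Y, |r u y| ≤ R) (hμ : μ ∈ W U f F z) : |rtilde r μ| ≤ R := by
  obtain ⟨hP, h1, -⟩ := hμ
  have hm : MeasurableSet (U ×ˢ Y) := (hU.prod hY).isClosed.measurableSet
  have hUY : ∀ᵐ p ∂μ, p ∈ U ×ˢ Y := (prob_compl_eq_zero_iff hm).2 <|
    le_antisymm prob_le_one <| h1.symm.le.trans <| measure_mono <| prod_mono_right hzY
  have := norm_integral_le_of_norm_le_const (μ := μ) (f := fun p => r p.1 p.2) (C := R)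
    (hUY.mono fun p hp => hR _ hp.1 _ hp.2)
  simpa [rtilde] using this

theorem abs_integral_exp_mul_le {C R T : ℝ} {a : ℝ → ℝ} (hC : 0 < C) (hT : 0 < T)
    (ha : ∀ t, 0 ≤ t → |a t| ≤ R) : |∫ t in (0:ℝ)..T, Real.exp (-C * t) * a t| ≤ R * T := by
  have := intervalIntegral.norm_integral_le_of_norm_le_const (a := 0) (b := T) (C := R)
    (f := fun t => Real.exp (-C * t) * a t) fun t ht => by
      rw [uIoc_of_le hT.le] at ht
      rw [norm_mul, Real.norm_eq_abs, Real.abs_exp]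
      exact (mul_le_of_le_one_left (norm_nonneg _) (Real.exp_le_one_iff.2
        (by nlinarith [ht.1]))).trans (ha t ht.1.le)
  rwa [sub_zero, abs_of_pos hT] at this

end

/-- Theorem on averaging approximation, Theorem 2.3 of the paper:
under continuity of `W` and viability of the averaged system in `Z`, the trajectories
of the slow observables of the perturbed system staying in a compact subset of the
interior of `Z` are approximated (together with the running discounted cost) by
solutions of the averaged system. -/
theorem statement0
    {d m k : ℕ}
    (Uset : Set (Dd d)) (Yset : Set (Em m)) (Zset : Set (Kk k))
    (f g : Dd d → Em m → Em m) (F : Em m → Kk k) (r : Dd d → Em m → ℝ)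
    (C : ℝ) (y₀ : Em m)
    (hU : IsCompact Uset) (hY : IsCompact Yset) (hZ : IsCompact Zset)
    (hfC : Continuous fun p : Dd d × Em m => f p.1 p.2)
    (hgC : Continuous fun p : Dd d × Em m => g p.1 p.2)
    (hrC : Continuous fun p : Dd d × Em m => r p.1 p.2)
    (hfL : ∃ L : ℝ≥0, ∀ u ∈ Uset, LipschitzWith L (f u))
    (hgL : ∃ L : ℝ≥0, ∀ u ∈ Uset, LipschitzWith L (g u))
    (hrL : ∃ L : ℝ≥0, ∀ u ∈ Uset, LipschitzWith L (r u))
    (hF : ∃ V : Set (Em m), IsOpen V ∧ Yset ⊆ V ∧ ContDiffOn ℝ 1 F V ∧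
      ∃ LF : ℝ≥0, LipschitzOnWith LF (fun y => fderiv ℝ F y) V)
    (hInv : ∀ u ∈ Uset, ∀ y ∈ Yset, fderiv ℝ F y (f u y) = 0)
    (hYzY : ∀ z ∈ Zset, lvl F z ⊆ Yset)
    (hYzLip : ∃ L0 : ℝ, 0 ≤ L0 ∧ ∀ z' ∈ Zset, ∀ z'' ∈ Zset,
      hausdorffDist (lvl F z') (lvl F z'') ≤ L0 * ‖z' - z''‖)
    (hC : 0 < C) (hy₀ : y₀ ∈ Yset) (hz₀ : F y₀ ∈ Zset)
    (hWcont : WCont Uset f F Zset)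
    (hViable : AveragedViable Uset f F g Zset)
    (Zc : Set (Kk k)) (hZc : IsCompact Zc) (hZcInt : Zc ⊆ interior Zset)
    (T : ℝ) (hT : 0 < T) :
    ∃ β : ℝ → ℝ, Tendsto β (𝓝[>] (0:ℝ)) (𝓝 0) ∧
      ∀ ε > (0:ℝ), ∀ u y : ℝ → _, IsControl Uset u →
        IsSolOn (fun s x => ε⁻¹ • f (u s) x + g (u s) x) y → y 0 = y₀ →
        (∀ t : ℝ, 0 ≤ t → y t ∈ Yset ∧ F (y t) ∈ Zc) →
        ∃ μt zf, IsAveragedSol Uset f F g (F y₀) μt zf ∧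
          (∀ t : ℝ, 0 ≤ t → zf t ∈ Zset) ∧
          (∀ t ∈ Icc (0:ℝ) T, ‖F (y t) - zf t‖ ≤ β ε) ∧
          |(∫ t in (0:ℝ)..T, Real.exp (-C * t) * r (u t) (y t)) -
            ∫ t in (0:ℝ)..T, Real.exp (-C * t) * rtilde r (μt t)| ≤ β ε := by
  let P : ℝ → ℝ → Prop := fun ε b => ∀ u y : ℝ → _, IsControl Uset u →
    IsSolOn (fun s x => ε⁻¹ • f (u s) x + g (u s) x) y → y 0 = y₀ →
    (∀ t : ℝ, 0 ≤ t → y t ∈ Yset ∧ F (y t) ∈ Zc) →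
    ∃ μt zf, IsAveragedSol Uset f F g (F y₀) μt zf ∧
      (∀ t : ℝ, 0 ≤ t → zf t ∈ Zset) ∧
      (∀ t ∈ Icc (0:ℝ) T, ‖F (y t) - zf t‖ ≤ b) ∧
      |(∫ t in (0:ℝ)..T, Real.exp (-C * t) * r (u t) (y t)) -
        ∫ t in (0:ℝ)..T, Real.exp (-C * t) * rtilde r (μt t)| ≤ b
  have hmono : ∀ ε a b, a ≤ b → P ε a → P ε b := fun ε a b hab h u y hu hy hy0 hyY => by
    obtain ⟨μt, zf, h1, h2, h3, h4⟩ := h u y hu hy hy0 hyY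
    exact ⟨μt, zf, h1, h2, fun t ht => (h3 t ht).trans hab, h4.trans hab⟩
  have hZcZ : Zc ⊆ Zset := hZcInt.trans interior_subset
  obtain ⟨R, hR⟩ := (hU.prod hY).exists_bound_of_continuousOn hrC.continuousOn
  obtain ⟨S, hS⟩ := hZ.exists_bound_of_continuousOn continuousOn_id
  have hbound : ∀ ε > 0, P ε (max (S + S) (R * T + R * T)) := fun ε _ u y hu _ _ hyY => by
    obtain ⟨μt, zf, hsol, hzf⟩ := hViable _ hz₀
    refine ⟨μt, zf, hsol, hzf, fun t ht => ?_, ?_⟩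
    · exact (norm_sub_le_of_le (hS _ (hZcZ (hyY t ht.1).2)) (hS _ (hzf t ht.1))).trans
        (le_max_left _ _)
    · refine ((abs_sub _ _).trans (add_le_add ?_ ?_)).trans (le_max_right _ _)
      · exact abs_integral_exp_mul_le hC hT fun t ht => hR (u t, y t) ⟨hu.2 t ht, (hyY t ht).1⟩
      · exact abs_integral_exp_mul_le hC hT fun t ht => abs_rtilde_le hU hY (hYzY _ (hzf t ht))
          (fun u hu y hy => hR (u, y) ⟨hu, hy⟩) (hsol.2.2.2.2 t ht)
  refine exists_tendsto_zero_of_eventually hmono hbound fun δ hδ => ?_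
  by_contra hfreq
  have hfreq' : ∃ᶠ ε in 𝓝[>] (0:ℝ), ε ∈ range (Subtype.val : {ε // 0 < ε ∧ ¬P ε δ} → ℝ) := by
    exact ((not_eventually.1 hfreq).and_eventually self_mem_nhdsWithin).mono
      fun ε h => ⟨⟨ε, h.2, h.1⟩, rfl⟩
  have := comap_neBot_iff_frequently.2 hfreq'
  let 𝒰 := Ultrafilter.of (comap (Subtype.val : {ε // 0 < ε ∧ ¬P ε δ} → ℝ) (𝓝[>] 0))
  have he : Tendsto (Subtype.val : {ε // 0 < ε ∧ ¬P ε δ} → ℝ) 𝒰 (𝓝 0) :=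
    (tendsto_comap.mono_left (Ultrafilter.of_le _)).mono_right nhdsWithin_le_nhds
  have hbad : ∀ i : {ε // 0 < ε ∧ ¬P ε δ}, ¬P i δ := fun i => i.2.2
  simp only [P, not_forall] at hbad
  choose u y hu hsol hy0 hyY hno using hbad
  obtain ⟨V, hV, hYV, hFV, -⟩ := hF
  obtain ⟨κ, z, hint, hz, hzZc, hW, hunif, hcost⟩ := exists_averaged_limit C hU hY hZc hfC hgC hrC
    hV hYV hFV hInv hT 𝒰 (fun i => i.2.1) he hu hsol hy0 hyY
  obtain ⟨μt, zf, hav, hzf, heq, hμκ⟩ := exists_averagedSol_extension hViable hT hint hz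
    (fun t ht => hZcZ (hzZc t ht)) hW
  have hcost_eq : ∫ t in (0:ℝ)..T, Real.exp (-C * t) * rtilde r (μt t) =
      ∫ t in (0:ℝ)..T, Real.exp (-C * t) * rtilde r (κ t) := by
    refine intervalIntegral.integral_congr_ae (hμκ.mono fun t h ht => ?_)
    rw [uIoc_of_le hT.le] at ht
    rw [h (Ioc_subset_Icc_self ht)]
  obtain ⟨i, h1, h2⟩ := ((Metric.tendstoUniformlyOn_iff.1 hunif δ hδ).and
    (Metric.tendsto_nhds.1 hcost δ hδ)).exists
  refine hno i ⟨μt, zf, hav, hzf, fun t ht => ?_, ?_⟩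
  · rw [heq ht, ← dist_eq_norm, dist_comm]
    exact (h1 t ht).le
  · rw [hcost_eq, ← Real.dist_eq]
    exact h2.le

end SlowObs
end
end

section
/- If the set-valued map z ↦ W(z) from Z to the compact subsets of P(U×Y) is continuous (with respect to the Hausdorff semimetric induced by ρ), then there exists β(S) → 0 as S → ∞ such that for every S > 0, every z ∈ Z, every control u(·) and every solution y(·) of the reduced system with y(0) ∈ Y_z (hence y(τ) ∈ Y_z for all τ ≥ 0), the occupational measure μ^{u(·),y(·),S} satisfies ρ(μ^{u(·),y(·),S}, W(z)) ≤ β(S); i.e., occupational measures generated on [0,S] approach W(z) as S → ∞, uniformly with respect to y(0) ∈ Y_z and z ∈ Z. -/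
open MeasureTheory Set Filter Metric
open scoped ENNReal NNReal Topology

noncomputable section

namespace SlowObs

variable {d m k : ℕ}

/-- Weak convergence of probability measures carried by a common compact set implies convergence
of the integrals of every continuous function, bounded or not. -/
lemma tendsto_integral_of_compact_support {X : Type*} [TopologicalSpace X] [MeasurableSpace X]
    [OpensMeasurableSpace X] {K : Set X} (hK : IsCompact K)
    {P : ℕ → ProbabilityMeasure X} {Q : ProbabilityMeasure X} (hPQ : Tendsto P atTop (𝓝 Q))
    (hP : ∀ n, ∀ᵐ x ∂(P n : Measure X), x ∈ K) (hQ : ∀ᵐ x ∂(Q : Measure X), x ∈ K)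
    {g : X → ℝ} (hg : Continuous g) :
    Tendsto (fun n => ∫ x, g x ∂(P n : Measure X)) atTop (𝓝 (∫ x, g x ∂(Q : Measure X))) := by
  obtain ⟨C, hC⟩ := hK.exists_bound_of_continuousOn hg.continuousOn
  have hbound : ∀ x, ‖max (-|C|) (min |C| (g x))‖ ≤ |C| := fun x =>
    abs_le.2 ⟨le_max_left _ _, max_le (by linarith [abs_nonneg C]) (min_le_left _ _)⟩
  let G : BoundedContinuousFunction X ℝ := BoundedContinuousFunction.ofNormedAddCommGroup
    (fun x => max (-|C|) (min |C| (g x))) (by fun_prop) |C| hbound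
  have hG : ∀ μ : Measure X, (∀ᵐ x ∂μ, x ∈ K) → ∫ x, G x ∂μ = ∫ x, g x ∂μ := by
    intro μ hμ
    refine integral_congr_ae (hμ.mono fun x hx => ?_)
    have h := abs_le.1 ((hC x hx).trans (le_abs_self C))
    change max (-|C|) (min |C| (g x)) = g x
    rw [min_eq_right h.2, max_eq_right h.1]
  have := ProbabilityMeasure.tendsto_iff_forall_integral_tendsto.1 hPQ G
  rw [hG _ hQ] at this
  exact this.congr fun n => hG _ (hP n)

/-- A closed set that eventually has full measure along a weakly convergent sequence of
probability measures has full measure for the limit. -/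
lemma ae_mem_of_tendsto {X : Type*} [TopologicalSpace X] [MeasurableSpace X]
    [OpensMeasurableSpace X] [HasOuterApproxClosed X]
    {P : ℕ → ProbabilityMeasure X} {Q : ProbabilityMeasure X} (hPQ : Tendsto P atTop (𝓝 Q))
    {C : Set X} (hC : IsClosed C) (hP : ∀ᶠ n in atTop, ∀ᵐ x ∂(P n : Measure X), x ∈ C) :
    ∀ᵐ x ∂(Q : Measure X), x ∈ C := by
  have h := ProbabilityMeasure.limsup_measure_closed_le_of_tendsto hPQ hC
  have hlim : (atTop.limsup fun n => (P n : Measure X) C) = 1 := by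
    refine Tendsto.limsup_eq (tendsto_const_nhds.congr' ?_)
    filter_upwards [hP] with n hn
    exact (prob_compl_eq_zero_iff hC.measurableSet).1 hn |>.symm
  rw [hlim] at h
  exact (prob_compl_eq_zero_iff hC.measurableSet).2 (le_antisymm prob_le_one h)

/-- The chain rule in integrated form along a Carathéodory solution with bounded velocity. -/
lemma integral_fderiv_along_solution {vf : ℝ → Em m → Em m} {y : ℝ → Em m}
    (hy : IsSolOn vf y) {C : ℝ} (hC : ∀ t, 0 ≤ t → ‖vf t (y t)‖ ≤ C)
    {φ : Em m → ℝ} (hφ : ContDiff ℝ 1 φ) {S : ℝ} (hS : 0 ≤ S) :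
    ∫ t in (0:ℝ)..S, fderiv ℝ φ (y t) (vf t (y t)) = φ (y S) - φ (y 0) := by
  obtain ⟨-, hint, heq⟩ := hy
  have hC0 : 0 ≤ C := (norm_nonneg _).trans (hC 0 le_rfl)
  have hlip : LipschitzOnWith C.toNNReal y (uIcc 0 S) := by
    rw [uIcc_of_le hS]
    refine LipschitzOnWith.of_dist_le_mul fun s hs t ht => ?_
    rw [Real.coe_toNNReal _ hC0, dist_eq_norm, Real.dist_eq, heq s hs.1, heq t ht.1,
      add_sub_add_left_eq_sub, intervalIntegral.integral_interval_sub_left (hint s) (hint t)]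
    refine intervalIntegral.norm_integral_le_of_norm_le_const fun r hr => hC r ?_
    exact (le_min ht.1 hs.1).trans hr.1.le
  obtain ⟨R, hR⟩ :=
    (isCompact_uIcc.image_of_continuousOn hlip.continuousOn).isBounded.subset_closedBall 0
  obtain ⟨L, hL⟩ := hφ.contDiffOn.exists_lipschitzOnWith one_ne_zero
    (convex_closedBall (0 : Em m) R) (isCompact_closedBall _ _)
  have hac : AbsolutelyContinuousOnInterval (φ ∘ y) 0 S :=
    (hL.comp hlip (fun t ht => hR ⟨t, ht, rfl⟩)).absolutelyContinuousOnInterval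
  have hsub : (φ ∘ y) S - (φ ∘ y) 0 = φ (y S) - φ (y 0) := rfl
  rw [← hsub, ← hac.integral_deriv_eq_sub]
  refine intervalIntegral.integral_congr_ae ?_
  filter_upwards [(hint S).ae_hasDerivAt_integral, Measure.ae_ne volume S] with t ht htS htm
  rw [uIoc_of_le hS] at htm
  have hd := ht (uIcc_of_le hS ▸ ⟨htm.1.le, htm.2⟩) 0 left_mem_uIcc
  have hdy : HasDerivAt y (vf t (y t)) t := by
    refine (hd.const_add (y 0)).congr_of_eventuallyEq ?_
    filter_upwards [Ioi_mem_nhds htm.1] with r hr using heq r (le_of_lt hr)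
  exact ((hφ.differentiable one_ne_zero (y t)).hasFDerivAt.comp_hasDerivAt t hdy).deriv.symm

lemma aemeasurable_pair {u : ℝ → Dd d} {y : ℝ → Em m} (hu : Measurable u)
    (hy : ContinuousOn y (Ici 0)) (S : ℝ) :
    AEMeasurable (fun τ => (u τ, y τ)) (volume.restrict (Ioc 0 S)) :=
  hu.aemeasurable.prodMk
    ((hy.mono fun _ ht => le_of_lt ht.1).aemeasurable measurableSet_Ioc)

lemma isProbabilityMeasure_occ {u : ℝ → Dd d} {y : ℝ → Em m} (hu : Measurable u)
    (hy : ContinuousOn y (Ici 0)) {S : ℝ} (hS : 0 < S) : IsProbabilityMeasure (occ u y S) := by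
  refine ⟨?_⟩
  rw [occ, Measure.smul_apply, Measure.map_apply_of_aemeasurable (aemeasurable_pair hu hy S)
    MeasurableSet.univ]
  simp [ENNReal.inv_mul_cancel (ENNReal.ofReal_pos.2 hS).ne' ENNReal.ofReal_ne_top]

lemma integral_occ {u : ℝ → Dd d} {y : ℝ → Em m} (hu : Measurable u)
    (hy : ContinuousOn y (Ici 0)) {S : ℝ} (hS : 0 < S) {g : Dd d × Em m → ℝ} (hg : Continuous g) :
    ∫ p, g p ∂(occ u y S) = S⁻¹ * ∫ τ in (0:ℝ)..S, g (u τ, y τ) := by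
  rw [occ, integral_smul_measure, integral_map (aemeasurable_pair hu hy S)
    hg.aestronglyMeasurable, intervalIntegral.integral_of_le hS.le, smul_eq_mul,
    ENNReal.toReal_inv, ENNReal.toReal_ofReal hS.le]

lemma ae_occ_mem {u : ℝ → Dd d} {y : ℝ → Em m} (hu : Measurable u)
    (hy : ContinuousOn y (Ici 0)) (S : ℝ) {C : Set (Dd d × Em m)} (hC : MeasurableSet C)
    (h : ∀ τ, 0 ≤ τ → (u τ, y τ) ∈ C) : ∀ᵐ p ∂(occ u y S), p ∈ C := by
  refine Measure.ae_smul_measure ?_ _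
  refine (ae_map_iff (p := fun p => p ∈ C) (aemeasurable_pair hu hy S) hC).2 ?_
  filter_upwards [ae_restrict_mem measurableSet_Ioc] with τ hτ using h τ hτ.1.le

/-- Admissible pairs of the reduced system in the level set `Y_z`. -/
def IsAdmissible (U : Set (Dd d)) (f : Dd d → Em m → Em m) (F : Em m → Kk k) (z : Kk k)
    (u : ℝ → Dd d) (y : ℝ → Em m) : Prop :=
  IsControl U u ∧ IsSolOn (fun s x => f (u s) x) y ∧ ∀ τ : ℝ, 0 ≤ τ → y τ ∈ lvl F z

/-- Weak limits of occupational measures over increasing horizons lie in `W`. -/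
lemma limit_mem_W {U : Set (Dd d)} {Y : Set (Em m)} {Z : Set (Kk k)}
    {f : Dd d → Em m → Em m} {F : Em m → Kk k} (hU : IsCompact U) (hY : IsCompact Y)
    (hf : Continuous fun p : Dd d × Em m => f p.1 p.2) (hF : ContinuousOn F Y)
    (hZY : ∀ z ∈ Z, lvl F z ⊆ Y)
    {S : ℕ → ℝ} (hSpos : ∀ n, 0 < S n) (hS : Tendsto S atTop atTop)
    {z : ℕ → Kk k} {z₀ : Kk k} (hz : ∀ n, z n ∈ Z) (hz₀ : Tendsto z atTop (𝓝 z₀))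
    {u : ℕ → ℝ → Dd d} {y : ℕ → ℝ → Em m} (hadm : ∀ n, IsAdmissible U f F (z n) (u n) (y n))
    {P : ℕ → ProbabilityMeasure (Dd d × Em m)} (hP : ∀ n, (P n : Measure _) = occ (u n) (y n) (S n))
    {Q : ProbabilityMeasure (Dd d × Em m)} (hPQ : Tendsto P atTop (𝓝 Q)) :
    (Q : Measure (Dd d × Em m)) ∈ W U f F z₀ := by
  have hK : IsCompact (U ×ˢ Y) := hU.prod hY
  have hmem : ∀ n τ, 0 ≤ τ → (u n τ, y n τ) ∈ U ×ˢ Y := fun n τ hτ =>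
    ⟨(hadm n).1.2 τ hτ, hZY _ (hz n) ((hadm n).2.2 τ hτ)⟩
  have hPK : ∀ n, ∀ᵐ p ∂(P n : Measure (Dd d × Em m)), p ∈ U ×ˢ Y := fun n => by
    rw [hP n]
    exact ae_occ_mem (hadm n).1.1 (hadm n).2.1.1 _ hK.measurableSet (hmem n)
  have hQK := ae_mem_of_tendsto hPQ hK.isClosed (Eventually.of_forall hPK)
  refine ⟨inferInstance, ?_, fun φ hφ => ?_⟩
  · have hFsnd : ContinuousOn (fun p : Dd d × Em m => F p.2) (U ×ˢ Y) :=
      hF.comp continuousOn_snd fun p hp => hp.2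
    have hclosed : ∀ ε : ℝ,
        IsClosed ((U ×ˢ Y) ∩ (fun p : Dd d × Em m => dist (F p.2) z₀) ⁻¹' Iic ε) := fun ε =>
      (continuous_dist.comp_continuousOn (hFsnd.prodMk continuousOn_const)).preimage_isClosed_of_isClosed
        hK.isClosed isClosed_Iic
    have hε : ∀ j : ℕ, ∀ᵐ p ∂(Q : Measure (Dd d × Em m)), dist (F p.2) z₀ ≤ 1 / ((j : ℝ) + 1) := by
      intro j
      refine (ae_mem_of_tendsto hPQ (hclosed (1 / ((j : ℝ) + 1))) ?_).mono fun p hp => hp.2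
      filter_upwards [Metric.tendsto_nhds.1 hz₀ _ (Nat.one_div_pos_of_nat (n := j))] with n hn
      rw [hP n]
      refine ae_occ_mem (hadm n).1.1 (hadm n).2.1.1 _ (hclosed _).measurableSet
        fun τ hτ => ⟨hmem n τ hτ, ?_⟩
      have : F (y n τ) = z n := (hadm n).2.2 τ hτ
      simpa [this] using hn.le
    have hae : ∀ᵐ p ∂(Q : Measure (Dd d × Em m)), p ∈ U ×ˢ lvl F z₀ := by
      filter_upwards [hQK, ae_all_iff.2 hε] with p hp hpε
      refine ⟨hp.1, dist_le_zero.1 ?_⟩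
      exact ge_of_tendsto' tendsto_one_div_add_atTop_nhds_zero_nat hpε
    exact (measure_congr (eventuallyEq_univ.2 hae)).trans measure_univ
  · have hcont : Continuous fun p : Dd d × Em m => fderiv ℝ φ p.2 (f p.1 p.2) :=
      ((hφ.continuous_fderiv one_ne_zero).comp continuous_snd).clm_apply hf
    refine tendsto_nhds_unique (tendsto_integral_of_compact_support hK hPQ hPK hQK hcont) ?_
    obtain ⟨C, hC⟩ := hK.exists_bound_of_continuousOn hf.continuousOn
    obtain ⟨B, hB⟩ := hY.exists_bound_of_continuousOn hφ.continuous.continuousOn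
    refine squeeze_zero_norm (a := fun n => (S n)⁻¹ * (B + B)) (fun n => ?_) ?_
    · rw [hP n, integral_occ (hadm n).1.1 (hadm n).2.1.1 (hSpos n) hcont,
        integral_fderiv_along_solution (hadm n).2.1 (fun t ht => hC (u n t, y n t) (hmem n t ht))
          hφ (hSpos n).le, norm_mul, Real.norm_of_nonneg (inv_nonneg.2 (hSpos n).le)]
      refine mul_le_mul_of_nonneg_left ?_ (inv_nonneg.2 (hSpos n).le)
      exact (norm_sub_le _ _).trans
        (add_le_add (hB _ (hmem n _ (hSpos n).le).2) (hB _ (hmem n 0 le_rfl).2))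
    · simpa using (tendsto_inv_atTop_zero.comp hS).mul_const (B + B)

/-- Along any sequence of admissible pairs with horizons going to infinity, a subsequence of the
levels and of the occupational measures converges, to a limit in the graph of `W`. -/
lemma exists_subseq_tendsto {U : Set (Dd d)} {Y : Set (Em m)} {Z : Set (Kk k)}
    {f : Dd d → Em m → Em m} {F : Em m → Kk k} (hU : IsCompact U) (hY : IsCompact Y)
    (hZ : IsCompact Z) (hf : Continuous fun p : Dd d × Em m => f p.1 p.2) (hF : ContinuousOn F Y)
    (hZY : ∀ z ∈ Z, lvl F z ⊆ Y)
    {S : ℕ → ℝ} (hSpos : ∀ n, 0 < S n) (hS : Tendsto S atTop atTop)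
    {z : ℕ → Kk k} (hz : ∀ n, z n ∈ Z)
    {u : ℕ → ℝ → Dd d} {y : ℕ → ℝ → Em m} (hadm : ∀ n, IsAdmissible U f F (z n) (u n) (y n)) :
    ∃ z₀ ∈ Z, ∃ ψ : ℕ → ℕ, ∃ μ ∈ W U f F z₀, Tendsto (z ∘ ψ) atTop (𝓝 z₀) ∧
      Tendsto (fun n => ρ (occ (u (ψ n)) (y (ψ n)) (S (ψ n))) μ) atTop (𝓝 0) := by
  have hK : IsCompact (U ×ˢ Y) := hU.prod hY
  let P : ℕ → ProbabilityMeasure (Dd d × Em m) := fun n =>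
    ⟨occ (u n) (y n) (S n), isProbabilityMeasure_occ (hadm n).1.1 (hadm n).2.1.1 (hSpos n)⟩
  have hcomp := isCompact_setOfPred_probabilityMeasure_mass_eq_compl_isCompact_le
    (E := Dd d × Em m) (u := fun _ => 0) (K := fun _ => U ×ˢ Y) tendsto_const_nhds
    (fun _ => hK) (Or.inr monotone_const)
  have hP : ∀ n, P n ∈ {μ : ProbabilityMeasure (Dd d × Em m) | ∀ _ : ℕ, μ (U ×ˢ Y)ᶜ ≤ 0} := by
    intro n _
    have h : (P n : Measure (Dd d × Em m)) (U ×ˢ Y)ᶜ = 0 :=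
      ae_occ_mem (hadm n).1.1 (hadm n).2.1.1 (S n) hK.measurableSet fun τ hτ =>
        ⟨(hadm n).1.2 τ hτ, hZY _ (hz n) ((hadm n).2.2 τ hτ)⟩
    exact ((ProbabilityMeasure.null_iff_toMeasure_null _ _).2 h).le
  obtain ⟨⟨z₀, Q⟩, hmem, ψ, hψ, hlim⟩ :=
    (hZ.prod hcomp).tendsto_subseq (x := fun n => (z n, P n)) fun n => ⟨hz n, hP n⟩
  rw [Prod.tendsto_iff] at hlim
  refine ⟨z₀, hmem.1, ψ, Q, ?_, hlim.1, ?_⟩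
  · exact limit_mem_W hU hY hf hF hZY (fun n => hSpos (ψ n)) (hS.comp hψ.tendsto_atTop)
      (fun n => hz (ψ n)) hlim.1 (fun n => hadm (ψ n)) (fun n => rfl) hlim.2
  · have h := (LevyProkhorov.continuous_ofMeasure_probabilityMeasure.tendsto Q).comp hlim.2
    exact tendsto_iff_edist_tendsto_0.1 h

lemma W_nonempty {U : Set (Dd d)} {Y : Set (Em m)} {Z : Set (Kk k)}
    {f : Dd d → Em m → Em m} {F : Em m → Kk k} (hU : IsCompact U) (hY : IsCompact Y)
    (hf : Continuous fun p : Dd d × Em m => f p.1 p.2) (hF : ContinuousOn F Y)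
    (hZY : ∀ z ∈ Z, lvl F z ⊆ Y) {z : Kk k} (hz : z ∈ Z)
    {u : ℝ → Dd d} {y : ℝ → Em m} (hadm : IsAdmissible U f F z u y) : (W U f F z).Nonempty := by
  obtain ⟨z₀, hz₀, -, μ, hμ, -⟩ := exists_subseq_tendsto (Z := {z}) hU hY isCompact_singleton hf hF
    (fun w hw => hw ▸ hZY z hz) (S := fun n => (n : ℝ) + 1) (fun n => by positivity)
    (tendsto_atTop_add_const_right _ _ tendsto_natCast_atTop_atTop) (z := fun _ => z)
    (fun _ => rfl) (fun _ => hadm)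
  exact ⟨μ, hz₀ ▸ hμ⟩

lemma ρpt_le_add_ρH {μ ν : Measure (Dd d × Em m)} {Γ₁ Γ₂ : Set (Measure (Dd d × Em m))}
    (hν : ν ∈ Γ₂) : ρpt μ Γ₁ ≤ ρ μ ν + ρH Γ₁ Γ₂ := by
  have h : ρpt ν Γ₁ ≤ ρH Γ₁ Γ₂ := le_trans
    (le_iSup₂ (f := fun ν (_ : ν ∈ Γ₂) => ρpt ν Γ₁) ν hν) (le_max_right _ _)
  refine le_trans ?_ (add_le_add_right h _)
  simp only [ρpt, ENNReal.add_iInf]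
  exact iInf₂_mono fun κ _ => levyProkhorovEDist_triangle μ ν κ

lemma ρpt_le_one {μ : Measure (Dd d × Em m)} [IsProbabilityMeasure μ] {U : Set (Dd d)}
    {f : Dd d → Em m → Em m} {F : Em m → Kk k} {z : Kk k} (h : (W U f F z).Nonempty) :
    ρpt μ (W U f F z) ≤ 1 := by
  obtain ⟨ν, hν⟩ := h
  have := hν.1
  refine (iInf₂_le ν hν).trans ((levyProkhorovEDist_le_max_measure_univ μ ν).trans ?_)
  simp

/-- Occupational measures over long horizons are uniformly close to `W`. -/
lemma exists_horizon {U : Set (Dd d)} {Y : Set (Em m)} {Z : Set (Kk k)}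
    {f : Dd d → Em m → Em m} {F : Em m → Kk k} (hU : IsCompact U) (hY : IsCompact Y)
    (hZ : IsCompact Z) (hf : Continuous fun p : Dd d × Em m => f p.1 p.2) (hF : ContinuousOn F Y)
    (hZY : ∀ z ∈ Z, lvl F z ⊆ Y) (hW : WCont U f F Z) {ε : ℝ≥0∞} (hε : 0 < ε) :
    ∃ S₀ : ℝ, ∀ S > S₀, ∀ z ∈ Z, ∀ u y, IsAdmissible U f F z u y →
      ρpt (occ u y S) (W U f F z) ≤ ε := by
  by_contra! hcon
  choose S hS z hz u y hadm hlt using fun n : ℕ => hcon n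
  obtain ⟨z₀, hz₀, ψ, μ, hμ, hzlim, hρ⟩ := exists_subseq_tendsto hU hY hZ hf hF hZY
    (fun n => (Nat.cast_nonneg n).trans_lt (hS n))
    (tendsto_atTop_mono (fun n => (hS n).le) tendsto_natCast_atTop_atTop) hz hadm
  have hε2 : 0 < ε / 2 := ENNReal.half_pos hε.ne'
  obtain ⟨δ, hδ, hH⟩ := hW z₀ hz₀ _ hε2
  obtain ⟨n, hn₁, hn₂⟩ := ((hρ.eventually (gt_mem_nhds hε2)).and
    (Metric.tendsto_nhds.1 hzlim δ hδ)).exists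
  refine (hlt (ψ n)).not_ge ?_
  calc ρpt (occ (u (ψ n)) (y (ψ n)) (S (ψ n))) (W U f F (z (ψ n)))
      ≤ _ := ρpt_le_add_ρH hμ
    _ ≤ ε / 2 + ε / 2 := add_le_add hn₁.le (hH _ (hz _) (by rwa [← dist_eq_norm])).le
    _ = ε := ENNReal.add_halves ε

/-- Proposition 2.1 of the paper: if `z ↦ W(z)` is continuous, then the
occupational measures generated on `[0,S]` by controls and solutions of the reduced system
starting in `Y_z` approach `W(z)` as `S → ∞`, uniformly in `y(0) ∈ Y_z` and `z ∈ Z`. -/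
theorem statement4
    {d m k : ℕ}
    (Uset : Set (Dd d)) (Yset : Set (Em m)) (Zset : Set (Kk k))
    (f : Dd d → Em m → Em m) (F : Em m → Kk k)
    (hU : IsCompact Uset) (hY : IsCompact Yset) (hZ : IsCompact Zset)
    (hfC : Continuous fun p : Dd d × Em m => f p.1 p.2)
    (hfL : ∃ L : ℝ≥0, ∀ u ∈ Uset, LipschitzWith L (f u))
    (hF : ∃ V : Set (Em m), IsOpen V ∧ Yset ⊆ V ∧ ContDiffOn ℝ 1 F V ∧
      ∃ LF : ℝ≥0, LipschitzOnWith LF (fun y => fderiv ℝ F y) V)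
    (hInv : ∀ u ∈ Uset, ∀ y ∈ Yset, fderiv ℝ F y (f u y) = 0)
    (hYzY : ∀ z ∈ Zset, lvl F z ⊆ Yset)
    (hWcont : WCont Uset f F Zset) :
    ∃ β : ℝ → ℝ, Tendsto β atTop (𝓝 0) ∧
      ∀ S > (0:ℝ), ∀ z ∈ Zset, ∀ u y, IsControl Uset u →
        IsSolOn (fun s x => f (u s) x) y → y 0 ∈ lvl F z →
        (∀ τ : ℝ, 0 ≤ τ → y τ ∈ lvl F z) →
        ρpt (occ u y S) (W Uset f F z) ≤ ENNReal.ofReal (β S) := by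
  obtain ⟨V, -, hYV, hFV, -⟩ := hF
  have hFY : ContinuousOn F Yset := hFV.continuousOn.mono hYV
  let b : ℝ → ℝ≥0∞ := fun S => ⨆ (z ∈ Zset) (u) (y) (_ : IsAdmissible Uset f F z u y),
    ρpt (occ u y S) (W Uset f F z)
  have hb_le : ∀ {S : ℝ}, 0 < S → b S ≤ 1 := fun {S} hS => by
    refine iSup₂_le fun z hz => iSup₂_le fun u y => iSup_le fun hadm => ?_
    have := isProbabilityMeasure_occ hadm.1.1 hadm.2.1.1 hS
    exact ρpt_le_one (W_nonempty hU hY hfC hFY hYzY hz hadm)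
  have hb_lim : Tendsto b atTop (𝓝 0) := by
    refine ENNReal.tendsto_nhds_zero.2 fun ε hε => ?_
    obtain ⟨S₀, hS₀⟩ := exists_horizon hU hY hZ hfC hFY hYzY hWcont hε
    filter_upwards [eventually_gt_atTop S₀] with S hS
    exact iSup₂_le fun z hz => iSup₂_le fun u y => iSup_le fun hadm => hS₀ S hS z hz u y hadm
  refine ⟨fun S => (b S).toReal, (ENNReal.tendsto_toReal ENNReal.zero_ne_top).comp hb_lim,
    fun S hS z hz u y hu hy _ hlvl => ?_⟩
  rw [ENNReal.ofReal_toReal ((hb_le hS).trans_lt ENNReal.one_lt_top).ne]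
  exact le_iSup₂_of_le z hz <| le_iSup₂_of_le u y <|
    le_iSup_of_le (f := fun _ => ρpt (occ u y S) (W Uset f F z)) ⟨hu, hy, hlvl⟩ le_rfl

end SlowObs
end
end
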